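/- Let n ≥ 2, m ≥ 1, 0 < p < ∞, s_1,…,s_m > −1, and let μ be a positive Borel measure on ℝ^{n+1}_+. Then the following are equivalent: (i) there is C > 0 with μ(Q_w) ≤ C·s^{m(n+1)+s_1+⋯+s_m} for every w = (y,s) ∈ ℝ^{n+1}_+; (ii) there is C' > 0 such that for all f_1 ∈ A_{s_1}^p, …, f_m ∈ A_{s_m}^p one has ∫_{ℝ^{n+1}_+} ∏_{j=1}^m |f_j(z)|^p dμ(z) ≤ C' ∏_{j=1}^m ‖f_j‖_{A_{s_j}^p}^p. -/

import Mathlib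

open MeasureTheory Real Set
open scoped ENNReal

noncomputable section

abbrev Euc (N : ℕ) : Type := EuclideanSpace ℝ (Fin N)

/-- The point `(x, t) ∈ ℝ^{n+1}`. -/
def pt {n : ℕ} (x : Euc n) (t : ℝ) : Euc (n + 1) :=
  (EuclideanSpace.equiv (Fin (n + 1)) ℝ).symm (Fin.snoc (fun i => x i) t)

/-- horizontal part of a point of ℝ^{n+1} -/
def xp {n : ℕ} (z : Euc (n + 1)) : Euc n :=
  (EuclideanSpace.equiv (Fin n) ℝ).symm (fun i => z i.castSucc)

/-- vertical part of a point of ℝ^{n+1} -/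
def tp {n : ℕ} (z : Euc (n + 1)) : ℝ := z (Fin.last n)

/-- The upper half space ℝ^{n+1}_+. -/
def upperHS (n : ℕ) : Set (Euc (n + 1)) := {z | 0 < tp z}

/-- |z - w̄| where z = (x,t), w̄ = (y, -s): Euclidean distance -/
def dB {n : ℕ} (x : Euc n) (t : ℝ) (y : Euc n) (s : ℝ) : ℝ :=
  dist (pt x t) (pt y (-s))

/-- the measure t^λ dx dt on ℝ^n × (0,∞), identified with ℝ^{n+1}_+ -/
def mLam (n : ℕ) (l : ℝ) : Measure (Euc n × ℝ) :=
  ((volume : Measure (Euc n)).prod ((volume : Measure ℝ).restrict (Ioi 0))).withDensity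
    (fun zt => ENNReal.ofReal (zt.2 ^ l))

/-- second derivative of `f` at `z` along direction `v` -/
def d2 {V : Type*} [NormedAddCommGroup V] [NormedSpace ℝ V] (f : V → ℝ) (z v : V) : ℝ :=
  iteratedFDeriv ℝ 2 f z ![v, v]

/-- `f` is harmonic on a subset of ℝ^N : twice continuously differentiable with
vanishing Laplacian. -/
def HarmonicOnE {N : ℕ} (f : Euc N → ℝ) (s : Set (Euc N)) : Prop :=
  ContDiffOn ℝ 2 f s ∧ ∀ z ∈ s, ∑ i, d2 f z (EuclideanSpace.single i 1) = 0

/-- `f` is harmonic on (ℝ^{n+1}_+)^m, viewed as an open subset of ℝ^{m(n+1)}. -/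
def HarmonicOnM {n m : ℕ} (f : (Fin m → Euc (n + 1)) → ℝ) : Prop :=
  ContDiffOn ℝ 2 f {z | ∀ j, z j ∈ upperHS n} ∧
  ∀ z ∈ {z : Fin m → Euc (n + 1) | ∀ j, z j ∈ upperHS n},
    ∑ j, ∑ i, d2 f z (Function.update (0 : Fin m → Euc (n + 1)) j (EuclideanSpace.single i 1)) = 0

/-- `f` is harmonic in each variable separately on (ℝ^{n+1}_+)^m -/
def HarmonicSep {n m : ℕ} (f : (Fin m → Euc (n + 1)) → ℝ) : Prop :=
  ∀ (j : Fin m) (z : Fin m → Euc (n + 1)), (∀ k, z k ∈ upperHS n) →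
    HarmonicOnE (fun w => f (Function.update z j w)) (upperHS n)

/-- the closed cube centered at (y,s) with side length s -/
def Qcube {n : ℕ} (y : Euc n) (s : ℝ) : Set (Euc (n + 1)) :=
  {z | (∀ i : Fin n, |z (Fin.castSucc i) - y i| ≤ s / 2) ∧ |tp z - s| ≤ s / 2}

/-- the A^p_λ (quasi)-norm, raised to the power p -/
def normAp (n : ℕ) (f : Euc (n + 1) → ℝ) (p l : ℝ) : ℝ≥0∞ :=
  ∫⁻ zt : Euc n × ℝ, ENNReal.ofReal (|f (pt zt.1 zt.2)| ^ p) ∂(mLam n l)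

/-- membership in the harmonic Bergman space A^p_λ -/
def memAp (n : ℕ) (f : Euc (n + 1) → ℝ) (p l : ℝ) : Prop :=
  HarmonicOnE f (upperHS n) ∧ normAp n f p l < ⊤

section MeanValue

variable {N : ℕ}

/-- The radial weight `(1 - |w|²)₊`. -/
def radialBump (w : Euc N) : ℝ := max 0 (1 - ‖w‖ ^ 2)

lemma continuous_radialBump : Continuous (radialBump (N := N)) := by
  unfold radialBump; fun_prop

lemma radialBump_nonneg (w : Euc N) : 0 ≤ radialBump w := le_max_left _ _

lemma radialBump_le_one (w : Euc N) : radialBump w ≤ 1 :=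
  max_le zero_le_one (by nlinarith [sq_nonneg ‖w‖])

lemma radialBump_eq_zero {w : Euc N} (hw : 1 ≤ ‖w‖) : radialBump w = 0 :=
  max_eq_left (by nlinarith)

lemma hasCompactSupport_radialBump : HasCompactSupport (radialBump (N := N)) := by
  refine HasCompactSupport.intro (isCompact_closedBall 0 1) fun w hw => radialBump_eq_zero ?_
  simp only [Metric.mem_closedBall, dist_zero_right, not_le] at hw
  exact hw.le

lemma integral_radialBump_pos : 0 < ∫ w : Euc N, radialBump w :=
  continuous_radialBump.integral_pos_of_hasCompactSupport_nonneg_nonzero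
    hasCompactSupport_radialBump radialBump_nonneg (x := 0) (by simp [radialBump])

lemma hasDerivAt_max_zero_sq (x : ℝ) : HasDerivAt (fun x : ℝ => (max 0 x) ^ 2) (2 * max 0 x) x := by
  rcases lt_trichotomy x 0 with h | rfl | h
  · have : (fun x : ℝ => (max 0 x) ^ 2) =ᶠ[nhds x] fun _ => 0 := by
      filter_upwards [Iio_mem_nhds h] with y hy
      simp [max_eq_left (le_of_lt (mem_Iio.1 hy))]
    rw [max_eq_left h.le, mul_zero]
    exact (hasDerivAt_const x (0 : ℝ)).congr_of_eventuallyEq this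
  · rw [hasDerivAt_iff_isLittleO_nhds_zero]
    simp only [zero_add, max_self, mul_zero, smul_zero, sub_zero]
    have : (fun h : ℝ => (max 0 h) ^ 2) =O[nhds 0] fun h => h ^ 2 := by
      refine Asymptotics.IsBigO.of_bound 1 (Filter.Eventually.of_forall fun h => ?_)
      rw [one_mul, norm_of_nonneg (by positivity), norm_of_nonneg (by positivity)]
      rcases le_total 0 h with h1 | h1
      · simp [h1]
      · simp [h1]; positivity
    simpa using this.trans_isLittleO (Asymptotics.isLittleO_pow_id one_lt_two)
  · have : (fun x : ℝ => (max 0 x) ^ 2) =ᶠ[nhds x] fun x => x ^ 2 := by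
      filter_upwards [Ioi_mem_nhds h] with y hy
      simp [max_eq_right (le_of_lt (mem_Ioi.1 hy))]
    rw [max_eq_right h.le]
    simpa using (hasDerivAt_pow 2 x).congr_of_eventuallyEq this

lemma hasFDerivAt_radialBump_sq (w : Euc N) :
    HasFDerivAt (fun w : Euc N => radialBump w ^ 2) (-(4 * radialBump w) • innerSL ℝ w) w := by
  have h1 : HasFDerivAt (fun w : Euc N => 1 - ‖w‖ ^ 2) (-(2 • innerSL ℝ w)) w := by
    simpa using ((hasStrictFDerivAt_norm_sq w).hasFDerivAt.const_sub 1)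
  have h2 := (hasDerivAt_max_zero_sq (1 - ‖w‖ ^ 2)).comp_hasFDerivAt w h1
  refine h2.congr_fderiv ?_
  ext v
  simp [radialBump]
  ring

lemma fderiv_apply_single_sum (f : Euc N → ℝ) (x w : Euc N) :
    fderiv ℝ f x w = ∑ i, w i * fderiv ℝ f x (EuclideanSpace.single i 1) := by
  conv_lhs => rw [← (EuclideanSpace.basisFun (Fin N) ℝ).sum_repr w]
  simp [map_sum]

lemma d2_eq_fderiv_fderiv (f : Euc N → ℝ) (x v : Euc N) :
    d2 f x v = fderiv ℝ (fderiv ℝ f) x v v := by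
  simp [d2, iteratedFDeriv_two_apply]

lemma integral_radialBump_mul_fderiv_eq_zero {f : Euc N → ℝ} (hf : ContDiff ℝ 2 f) {z : Euc N} {r : ℝ}
    (hL : ∀ w : Euc N, ‖w‖ < 1 → ∑ i, d2 f (z + r • w) (EuclideanSpace.single i 1) = 0) :
    ∫ w, radialBump w * fderiv ℝ f (z + r • w) w = 0 := by
  have hD : ContDiff ℝ 1 (fderiv ℝ f) := hf.fderiv_right (by norm_num)
  have hD2 : Continuous (fderiv ℝ (fderiv ℝ f)) := hD.continuous_fderiv (by norm_num)
  have hDc := hD.continuous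
  have hbc : Continuous (radialBump (N := N)) := continuous_radialBump
  have hb := hasCompactSupport_radialBump (N := N)
  have hsq : HasCompactSupport (fun w : Euc N => radialBump w ^ 2) := by
    simp only [sq]; exact hb.mul_left
  have hderiv : ∀ (i : Fin N) (w : Euc N),
      HasFDerivAt (fun w => fderiv ℝ f (z + r • w) (EuclideanSpace.single i 1))
        (r • (fderiv ℝ (fderiv ℝ f) (z + r • w)).flip (EuclideanSpace.single i 1)) w := by
    intro i w
    have h1 : HasFDerivAt (fun w : Euc N => z + r • w) (r • ContinuousLinearMap.id ℝ (Euc N)) w :=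
      ((hasFDerivAt_id w).const_smul r).const_add z
    have h2 := ((hD.differentiable (by norm_num)) (z + r • w)).hasFDerivAt.comp w h1
    have h3 := h2.clm_apply (hasFDerivAt_const (EuclideanSpace.single i (1 : ℝ)) w)
    refine h3.congr_fderiv ?_
    ext v
    simp
  have hibp : ∀ i : Fin N,
      ∫ w, fderiv ℝ f (z + r • w) (EuclideanSpace.single i 1) * (-(4 * radialBump w) * w i) =
      -∫ w, r * d2 f (z + r • w) (EuclideanSpace.single i 1) * radialBump w ^ 2 := by
    intro i
    have := integral_bilinear_hasFDerivAt_right_eq_neg_left_of_integrable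
      (μ := (volume : Measure (Euc N))) (B := ContinuousLinearMap.mul ℝ ℝ)
      (f := fun w => fderiv ℝ f (z + r • w) (EuclideanSpace.single i 1))
      (f' := fun w => r • (fderiv ℝ (fderiv ℝ f) (z + r • w)).flip (EuclideanSpace.single i 1))
      (g := fun w => radialBump w ^ 2) (g' := fun w => -(4 * radialBump w) • innerSL ℝ w)
      (v := EuclideanSpace.single i 1) ?_ ?_ ?_ (fun w _ => hderiv i w)
      (fun w _ => hasFDerivAt_radialBump_sq w)
    · simpa [d2_eq_fderiv_fderiv, EuclideanSpace.inner_single_right] using this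
    · refine Continuous.integrable_of_hasCompactSupport ?_ ?_
      · simp only [ContinuousLinearMap.mul_apply', smul_apply,
          ContinuousLinearMap.flip_apply]
        fun_prop
      · simp only [ContinuousLinearMap.mul_apply']; exact hsq.mul_left
    · refine Continuous.integrable_of_hasCompactSupport ?_ ?_
      · simp only [ContinuousLinearMap.mul_apply', smul_apply,
          innerSL_apply_apply]
        fun_prop
      · simp only [ContinuousLinearMap.mul_apply', smul_apply, smul_eq_mul]
        exact ((hb.mul_left (f := fun _ => (4 : ℝ))).neg.mul_right).mul_left
    · refine Continuous.integrable_of_hasCompactSupport ?_ ?_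
      · simp only [ContinuousLinearMap.mul_apply']
        fun_prop
      · simp only [ContinuousLinearMap.mul_apply']; exact hsq.mul_left
  have hInt : ∀ i : Fin N, Integrable fun w : Euc N =>
      fderiv ℝ f (z + r • w) (EuclideanSpace.single i 1) * (-(4 * radialBump w) * w i) := by
    intro i
    refine Continuous.integrable_of_hasCompactSupport (by fun_prop) ?_
    exact ((hb.mul_left (f := fun _ => (4 : ℝ))).neg.mul_right).mul_left
  have hint2 : ∀ i : Fin N, Integrable fun w : Euc N =>
      r * d2 f (z + r • w) (EuclideanSpace.single i 1) * radialBump w ^ 2 := by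
    intro i
    simp only [d2_eq_fderiv_fderiv]
    exact Continuous.integrable_of_hasCompactSupport (by fun_prop) hsq.mul_left
  have hsum : ∑ i : Fin N, ∫ w, fderiv ℝ f (z + r • w) (EuclideanSpace.single i 1) *
      (-(4 * radialBump w) * w i) = 0 := by
    simp only [hibp, Finset.sum_neg_distrib, neg_eq_zero]
    rw [← integral_finsetSum _ fun i _ => hint2 i]
    refine integral_eq_zero_of_ae (Filter.Eventually.of_forall fun w => ?_)
    simp only [← Finset.sum_mul, ← Finset.mul_sum, Pi.zero_apply]
    rcases lt_or_ge ‖w‖ 1 with hw | hw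
    · rw [hL w hw]; ring
    · rw [radialBump_eq_zero hw]; ring
  rw [← integral_finsetSum _ fun i _ => hInt i] at hsum
  have : ∀ w : Euc N, ∑ i, fderiv ℝ f (z + r • w) (EuclideanSpace.single i 1) *
      (-(4 * radialBump w) * w i) = -4 * (radialBump w * fderiv ℝ f (z + r • w) w) := by
    intro w
    rw [fderiv_apply_single_sum f _ w, Finset.mul_sum, Finset.mul_sum]
    exact Finset.sum_congr rfl fun i _ => by ring
  simp only [this, integral_const_mul] at hsum
  linarith

lemma hasDerivAt_integral_radialBump_mul {f : Euc N → ℝ} (hf : ContDiff ℝ 2 f)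
    (hc : HasCompactSupport f) (z : Euc N) (r : ℝ) :
    HasDerivAt (fun r : ℝ => ∫ w, radialBump w * f (z + r • w))
      (∫ w, radialBump w * fderiv ℝ f (z + r • w) w) r := by
  have hDc : Continuous (fderiv ℝ f) := hf.continuous_fderiv (by norm_num)
  have hfc := hf.continuous
  have hbc : Continuous (radialBump (N := N)) := continuous_radialBump
  have hb := hasCompactSupport_radialBump (N := N)
  obtain ⟨M, hM⟩ := hDc.bounded_above_of_compact_support (hc.fderiv (𝕜 := ℝ))
  refine (hasDerivAt_integral_of_dominated_loc_of_deriv_le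
    (F := fun r w => radialBump w * f (z + r • w))
    (F' := fun r w => radialBump w * fderiv ℝ f (z + r • w) w)
    (bound := fun w => radialBump w * (M * ‖w‖)) Filter.univ_mem ?_ ?_ ?_ ?_ ?_ ?_).2
  · exact Filter.Eventually.of_forall fun t =>
      (by fun_prop : Continuous fun w => radialBump w * f (z + t • w)).aestronglyMeasurable
  · exact Continuous.integrable_of_hasCompactSupport (by fun_prop) hb.mul_right
  · exact (by fun_prop :
      Continuous fun w => radialBump w * fderiv ℝ f (z + r • w) w).aestronglyMeasurable
  · refine Filter.Eventually.of_forall fun w t _ => ?_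
    rw [norm_mul, norm_of_nonneg (radialBump_nonneg w)]
    exact mul_le_mul_of_nonneg_left (ContinuousLinearMap.le_of_opNorm_le _ (hM _) _)
      (radialBump_nonneg w)
  · exact Continuous.integrable_of_hasCompactSupport (by fun_prop) hb.mul_right
  · refine Filter.Eventually.of_forall fun w t _ => ?_
    have h1 : HasDerivAt (fun t : ℝ => z + t • w) w t := by
      simpa using ((hasDerivAt_id t).smul_const w).const_add z
    exact (((hf.differentiable (by norm_num)) _).hasFDerivAt.comp_hasDerivAt t h1).const_mul _

lemma integral_radialBump_mul_eq {f : Euc N → ℝ} (hf : ContDiff ℝ 2 f)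
    (hc : HasCompactSupport f) {z : Euc N} {R : ℝ} (hR : 0 < R)
    (hL : ∀ x ∈ Metric.ball z R, ∑ i, d2 f x (EuclideanSpace.single i 1) = 0) :
    ∫ w, radialBump w * f (z + R • w) = (∫ w : Euc N, radialBump w) * f z := by
  have hd := hasDerivAt_integral_radialBump_mul hf hc z
  have h := constant_of_has_deriv_right_zero
    (f := fun r : ℝ => ∫ w, radialBump w * f (z + r • w)) (a := 0) (b := R)
    (fun r _ => (hd r).continuousAt.continuousWithinAt) (fun r hr => ?_) R ⟨hR.le, le_rfl⟩
  · simpa [integral_mul_const] using h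
  · have := (hd r).hasDerivWithinAt (s := Ici r)
    rwa [integral_radialBump_mul_fderiv_eq_zero hf] at this
    intro w hw
    refine hL _ ?_
    simp only [Metric.mem_ball, dist_self_add_left, norm_smul, norm_of_nonneg hr.1]
    nlinarith [hr.1, hr.2, norm_nonneg w]

lemma d2_congr_of_eventuallyEq {f g : Euc N → ℝ} {x : Euc N} (h : f =ᶠ[nhds x] g) (v : Euc N) :
    d2 f x v = d2 g x v := by
  simp only [d2, (h.iteratedFDeriv ℝ 2).eq_of_nhds]

lemma abs_mul_pow_le_integral_of_harmonic {f : Euc N → ℝ} {U : Set (Euc N)} (hU : IsOpen U)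
    (hf : HarmonicOnE f U) {z : Euc N} {R : ℝ} (hR : 0 < R)
    (hz : Metric.closedBall z (2 * R) ⊆ U) :
    (∫ w : Euc N, radialBump w) * |f z| * R ^ N ≤ ∫ x in Metric.closedBall z R, |f x| := by
  let χ : ContDiffBump z := ⟨R, 2 * R, hR, by linarith⟩
  set g : Euc N → ℝ := fun x => χ x * f x with hg
  have hgc : HasCompactSupport g := χ.hasCompactSupport.mul_right
  have hgd : ContDiff ℝ 2 g := by
    rw [contDiff_iff_contDiffAt]
    intro x
    by_cases hx : x ∈ Metric.closedBall z (2 * R)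
    · exact χ.contDiffAt.mul (hf.1.contDiffAt (hU.mem_nhds (hz hx)))
    · have : g =ᶠ[nhds x] fun _ => 0 := by
        filter_upwards [Metric.isClosed_closedBall.isOpen_compl.mem_nhds hx] with y hy
        have : χ y = 0 := χ.zero_of_le_dist (by
          simp only [mem_compl_iff, Metric.mem_closedBall, not_le] at hy; exact hy.le)
        simp [hg, this]
      exact contDiffAt_const.congr_of_eventuallyEq this
  have hgf : ∀ x ∈ Metric.closedBall z R, g x = f x := fun x hx => by
    simp [hg, χ.one_of_mem_closedBall hx]
  have hsub : Metric.closedBall z R ⊆ U :=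
    (Metric.closedBall_subset_closedBall (by linarith)).trans hz
  have hL : ∀ x ∈ Metric.ball z R, ∑ i, d2 g x (EuclideanSpace.single i 1) = 0 := by
    intro x hx
    rw [← hf.2 x (hsub (Metric.ball_subset_closedBall hx))]
    refine Finset.sum_congr rfl fun i _ => d2_congr_of_eventuallyEq ?_ _
    filter_upwards [Metric.isOpen_ball.mem_nhds hx] with y hy
    exact hgf y (Metric.ball_subset_closedBall hy)
  have hmv := integral_radialBump_mul_eq hgd hgc hR hL
  have hgcont := hgd.continuous
  have hbc : Continuous (radialBump (N := N)) := continuous_radialBump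
  have hz0 : g z = f z := hgf z (Metric.mem_closedBall_self hR.le)
  have hcv : ∫ w, radialBump w * |g (z + R • w)| =
      (R ^ N)⁻¹ * ∫ x, radialBump (R⁻¹ • (x - z)) * |g x| := by
    have h1 := Measure.integral_comp_smul (volume : Measure (Euc N))
      (fun u => radialBump (R⁻¹ • u) * |g (z + u)|) R
    have h2 := integral_add_left_eq_self (μ := (volume : Measure (Euc N)))
      (fun x => radialBump (R⁻¹ • (x - z)) * |g x|) z
    simp only [add_sub_cancel_left] at h2
    rw [h2, finrank_euclideanSpace_fin, abs_of_pos (by positivity)] at h1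
    simpa [smul_smul, inv_mul_cancel₀ hR.ne'] using h1
  have hle : ∫ x, radialBump (R⁻¹ • (x - z)) * |g x| ≤ ∫ x in Metric.closedBall z R, |f x| := by
    rw [← integral_indicator Metric.isClosed_closedBall.measurableSet]
    refine integral_mono ?_ ?_ fun x => ?_
    · refine Continuous.integrable_of_hasCompactSupport (by fun_prop) ?_
      exact HasCompactSupport.mul_left (hgc.abs)
    · rw [integrable_indicator_iff Metric.isClosed_closedBall.measurableSet]
      exact ((hf.1.continuousOn.mono hsub).abs).integrableOn_compact (isCompact_closedBall z R)
    · by_cases hx : x ∈ Metric.closedBall z R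
      · simp only [indicator_of_mem hx, hgf x hx]
        exact mul_le_of_le_one_left (abs_nonneg _) (radialBump_le_one _)
      · simp only [indicator_of_notMem hx]
        rw [radialBump_eq_zero, zero_mul]
        simp only [Metric.mem_closedBall, not_le, dist_eq_norm] at hx
        rw [norm_smul, norm_inv, norm_of_nonneg hR.le, ← div_eq_inv_mul, one_le_div hR]
        exact hx.le
  have habs : (∫ w : Euc N, radialBump w) * |f z| ≤ ∫ w, radialBump w * |g (z + R • w)| := by
    rw [← abs_of_pos (integral_radialBump_pos (N := N)), ← abs_mul, ← hz0, ← hmv]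
    refine (abs_integral_le_integral_abs).trans_eq ?_
    refine integral_congr_ae (Filter.Eventually.of_forall fun w => ?_)
    simp only [abs_mul, abs_of_nonneg (radialBump_nonneg w)]
  have hRN : 0 < R ^ N := by positivity
  calc (∫ w : Euc N, radialBump w) * |f z| * R ^ N
      ≤ ((R ^ N)⁻¹ * ∫ x in Metric.closedBall z R, |f x|) * R ^ N := by
        refine mul_le_mul_of_nonneg_right (habs.trans ?_) hRN.le
        rw [hcv]
        exact mul_le_mul_of_nonneg_left hle (by positivity)
    _ = ∫ x in Metric.closedBall z R, |f x| := by field_simp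

lemma exists_le_mul_add_mul_rpow {p : ℝ} (hp : 0 < p) {ε T : ℝ} (hε : 0 < ε) (hT : 0 < T) :
    ∃ L > 0, ∀ A B : ℝ, 0 < A → 0 ≤ B → B ^ p ≤ T * A ^ p →
      B ≤ ε * A + L * A ^ (1 - p) * B ^ p := by
  refine ⟨max ((T ^ (1 / p)) ^ (1 - p)) (ε ^ (1 - p)), by positivity, fun A B hA hB h => ?_⟩
  rcases hB.eq_or_lt with rfl | hB
  · positivity
  have hsplit : B = B ^ (1 - p) * B ^ p := by rw [← Real.rpow_add hB]; simp
  rcases le_total B (ε * A) with hBA | hBA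
  · exact hBA.trans (le_add_of_nonneg_right (by positivity))
  have key : B ^ (1 - p) ≤ max ((T ^ (1 / p)) ^ (1 - p)) (ε ^ (1 - p)) * A ^ (1 - p) := by
    rcases le_total p 1 with h1 | h1
    · have hB' : B ≤ T ^ (1 / p) * A := by
        rw [← Real.rpow_le_rpow_iff hB.le (by positivity) hp,
          Real.mul_rpow (by positivity) hA.le, ← Real.rpow_mul hT.le, one_div_mul_cancel hp.ne',
          Real.rpow_one]
        exact h
      calc B ^ (1 - p) ≤ (T ^ (1 / p) * A) ^ (1 - p) :=
            Real.rpow_le_rpow hB.le hB' (by linarith)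
        _ = (T ^ (1 / p)) ^ (1 - p) * A ^ (1 - p) := Real.mul_rpow (by positivity) hA.le
        _ ≤ _ := mul_le_mul_of_nonneg_right (le_max_left _ _) (by positivity)
    · calc B ^ (1 - p) ≤ (ε * A) ^ (1 - p) :=
            Real.rpow_le_rpow_of_nonpos (by positivity) hBA (by linarith)
        _ = ε ^ (1 - p) * A ^ (1 - p) := Real.mul_rpow (by positivity) hA.le
        _ ≤ _ := mul_le_mul_of_nonneg_right (le_max_right _ _) (by positivity)
  calc B = B ^ (1 - p) * B ^ p := hsplit
    _ ≤ max ((T ^ (1 / p)) ^ (1 - p)) (ε ^ (1 - p)) * A ^ (1 - p) * B ^ p :=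
        mul_le_mul_of_nonneg_right key (by positivity)
    _ ≤ _ := le_add_of_nonneg_left (by positivity)

/-- The Hardy-Littlewood sub-mean value property of `|f|^p`, for harmonic `f` and any `p > 0`. -/
theorem exists_rpow_abs_mul_pow_le_integral (hN : N ≠ 0) {p : ℝ} (hp : 0 < p) :
    ∃ K > 0, ∀ (f : Euc N → ℝ) (U : Set (Euc N)), IsOpen U → HarmonicOnE f U →
      ∀ (z : Euc N) (R : ℝ), 0 < R → Metric.closedBall z R ⊆ U →
        |f z| ^ p * R ^ N ≤ K * ∫ x in Metric.closedBall z R, |f x| ^ p := by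
  set c := ∫ w : Euc N, radialBump w with hc
  have hc0 : 0 < c := integral_radialBump_pos
  set V := (volume (Metric.closedBall (0 : Euc N) 1)).toReal with hV
  have hVol : ∀ (ζ : Euc N) (d : ℝ), 0 < d →
      volume.real (Metric.closedBall ζ d) = d ^ N * V := by
    intro ζ d hd
    rw [Measure.real, Measure.addHaar_closedBall' _ _ hd.le, ENNReal.toReal_mul,
      ENNReal.toReal_ofReal (by positivity), finrank_euclideanSpace_fin]
  have hV0 : 0 < V := ENNReal.toReal_pos
    (Metric.measure_closedBall_pos _ _ one_pos).ne' measure_closedBall_lt_top.ne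
  obtain ⟨L, hL0, hL⟩ := exists_le_mul_add_mul_rpow hp (ε := c / (2 * V)) (T := 2 ^ N)
    (by positivity) (by positivity)
  refine ⟨2 ^ N * (2 * c⁻¹ * L), by positivity, fun f U hU hf z R hR hz => ?_⟩
  have hcont : ContinuousOn (fun x => |f x| ^ p) (Metric.closedBall z R) :=
    ((hf.1.continuousOn.mono hz).abs).rpow_const fun _ _ => Or.inr hp.le
  obtain ⟨ζ, hζ, hmax⟩ := (isCompact_closedBall z R).exists_isMaxOn
    ⟨z, Metric.mem_closedBall_self hR.le⟩
    (f := fun x => |f x| ^ p * (R - dist x z) ^ N) (hcont.mul (by fun_prop))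
  have hzle : |f z| ^ p * R ^ N ≤ |f ζ| ^ p * (R - dist ζ z) ^ N := by
    simpa using hmax (Metric.mem_closedBall_self hR.le)
  have hJ0 : 0 ≤ ∫ x in Metric.closedBall z R, |f x| ^ p :=
    integral_nonneg fun x => by positivity
  refine hzle.trans ?_
  rcases (Metric.mem_closedBall.1 hζ).eq_or_lt with hd | hd
  · rw [hd, sub_self, zero_pow hN, mul_zero]; positivity
  rcases (abs_nonneg (f ζ)).eq_or_lt with hA | hA
  · rw [← hA, Real.zero_rpow hp.ne', zero_mul]; positivity
  obtain ⟨d, hd0, hd2⟩ : ∃ d, 0 < d ∧ R - dist ζ z = 2 * d :=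
    ⟨(R - dist ζ z) / 2, by linarith, by ring⟩
  rw [hd2]
  have hsub2 : Metric.closedBall ζ (2 * d) ⊆ Metric.closedBall z R :=
    Metric.closedBall_subset_closedBall' (by linarith)
  have hsub1 : Metric.closedBall ζ d ⊆ Metric.closedBall z R :=
    (Metric.closedBall_subset_closedBall (by linarith)).trans hsub2
  have hmean := abs_mul_pow_le_integral_of_harmonic hU hf hd0 (hsub2.trans hz)
  have hpt : ∀ x ∈ Metric.closedBall ζ d,
      |f x| ≤ c / (2 * V) * |f ζ| + L * |f ζ| ^ (1 - p) * |f x| ^ p := by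
    intro x hx
    refine hL _ _ hA (abs_nonneg _) ?_
    have h1 : |f x| ^ p * (R - dist x z) ^ N ≤ |f ζ| ^ p * (R - dist ζ z) ^ N := hmax (hsub1 hx)
    have h2 : d ≤ R - dist x z := by
      have := dist_triangle x ζ z
      have := Metric.mem_closedBall.1 hx
      linarith
    have h3 : |f x| ^ p * d ^ N ≤ |f x| ^ p * (R - dist x z) ^ N :=
      mul_le_mul_of_nonneg_left (pow_le_pow_left₀ hd0.le h2 N) (by positivity)
    rw [hd2, mul_pow] at h1
    have h4 : 0 < d ^ N := by positivity
    refine le_of_mul_le_mul_right ?_ h4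
    linarith
  have hInt : IntegrableOn (fun x => |f x| ^ p) (Metric.closedBall ζ d) :=
    (hcont.mono hsub1).integrableOn_compact (isCompact_closedBall _ _)
  have hintc : IntegrableOn (fun _ : Euc N => c / (2 * V) * |f ζ|) (Metric.closedBall ζ d) :=
    continuousOn_const.integrableOn_compact (isCompact_closedBall _ _)
  have hI : ∫ x in Metric.closedBall ζ d, |f x| ≤ c / (2 * V) * |f ζ| * (d ^ N * V) +
      L * |f ζ| ^ (1 - p) * ∫ x in Metric.closedBall ζ d, |f x| ^ p := by
    calc ∫ x in Metric.closedBall ζ d, |f x|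
        ≤ ∫ x in Metric.closedBall ζ d,
            (c / (2 * V) * |f ζ| + L * |f ζ| ^ (1 - p) * |f x| ^ p) := by
          refine setIntegral_mono_on ?_ (hintc.add (hInt.const_mul _))
            Metric.isClosed_closedBall.measurableSet hpt
          exact ((hf.1.continuousOn.mono (hsub1.trans hz)).abs).integrableOn_compact
            (isCompact_closedBall _ _)
      _ = _ := by
          rw [integral_add hintc (hInt.const_mul _), setIntegral_const, integral_const_mul,
            hVol ζ d hd0, smul_eq_mul]
          ring
  have hJ : ∫ x in Metric.closedBall ζ d, |f x| ^ p ≤ ∫ x in Metric.closedBall z R, |f x| ^ p :=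
    setIntegral_mono_set (hcont.integrableOn_compact (isCompact_closedBall _ _))
      (Filter.Eventually.of_forall fun x => by positivity) hsub1.eventuallyLE
  have hmain : |f ζ| * d ^ N ≤
      2 * c⁻¹ * L * |f ζ| ^ (1 - p) * ∫ x in Metric.closedBall z R, |f x| ^ p := by
    have h5 : c / (2 * V) * |f ζ| * (d ^ N * V) = c * (|f ζ| * d ^ N) / 2 := by field_simp
    have h6 : L * |f ζ| ^ (1 - p) * ∫ x in Metric.closedBall ζ d, |f x| ^ p ≤
        L * |f ζ| ^ (1 - p) * ∫ x in Metric.closedBall z R, |f x| ^ p :=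
      mul_le_mul_of_nonneg_left hJ (by positivity)
    have h7 : c * (|f ζ| * d ^ N) ≤
        2 * (L * |f ζ| ^ (1 - p) * ∫ x in Metric.closedBall z R, |f x| ^ p) := by
      linarith
    have h8 := mul_le_mul_of_nonneg_left h7 (inv_pos.2 hc0).le
    rw [inv_mul_cancel_left₀ hc0.ne'] at h8
    linarith
  have hA1 : |f ζ| ^ (p - 1) * |f ζ| = |f ζ| ^ p := by
    rw [Real.rpow_sub_one hA.ne']; field_simp
  have hA2 : |f ζ| ^ (p - 1) * |f ζ| ^ (1 - p) = 1 := by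
    rw [← Real.rpow_add hA]; simp
  calc |f ζ| ^ p * (2 * d) ^ N = 2 ^ N * (|f ζ| ^ (p - 1) * (|f ζ| * d ^ N)) := by
        rw [← mul_assoc (|f ζ| ^ (p - 1)), hA1, mul_pow]; ring
    _ ≤ 2 ^ N * (|f ζ| ^ (p - 1) *
        (2 * c⁻¹ * L * |f ζ| ^ (1 - p) * ∫ x in Metric.closedBall z R, |f x| ^ p)) := by
        gcongr
    _ = 2 ^ N * (2 * c⁻¹ * L) * (|f ζ| ^ (p - 1) * |f ζ| ^ (1 - p)) *
        ∫ x in Metric.closedBall z R, |f x| ^ p := by ring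
    _ = _ := by rw [hA2, mul_one]

end MeanValue

section HalfSpace

variable {n : ℕ}

lemma tp_pt (x : Euc n) (t : ℝ) : tp (pt x t) = t := by
  simp [tp, pt]

lemma pt_castSucc (x : Euc n) (t : ℝ) (i : Fin n) : pt x t i.castSucc = x i := by
  simp [pt]

lemma continuous_tp : Continuous (tp (n := n)) := by
  unfold tp; fun_prop

lemma isOpen_upperHS : IsOpen (upperHS n) := isOpen_lt continuous_const continuous_tp

lemma abs_tp_sub_le_dist (z w : Euc (n + 1)) : |tp z - tp w| ≤ dist z w := by
  rw [dist_eq_norm]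
  exact PiLp.norm_apply_le (z - w) (Fin.last n)

lemma abs_apply_sub_le_dist (z w : Euc (n + 1)) (i : Fin (n + 1)) : |z i - w i| ≤ dist z w := by
  rw [dist_eq_norm]
  exact PiLp.norm_apply_le (z - w) i

lemma exists_measurableEquiv_pt :
    ∃ e : Euc n × ℝ ≃ᵐ Euc (n + 1), (∀ zt, e zt = pt zt.1 zt.2) ∧
      MeasurePreserving e ((volume : Measure (Euc n)).prod (volume : Measure ℝ)) volume := by
  have h1 := (PiLp.volume_preserving_ofLp (Fin n)).prod (MeasurePreserving.id (volume : Measure ℝ))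
  have h2 := Measure.measurePreserving_swap (μ := (volume : Measure (Fin n → ℝ)))
    (ν := (volume : Measure ℝ))
  have h3 := (volume_preserving_piFinSuccAbove (fun _ : Fin (n + 1) => ℝ) (Fin.last n)).symm
  have h4 := PiLp.volume_preserving_toLp (Fin (n + 1))
  refine ⟨(((MeasurableEquiv.toLp 2 (Fin n → ℝ)).symm.prodCongr (MeasurableEquiv.refl ℝ)).trans
    MeasurableEquiv.prodComm).trans
    ((MeasurableEquiv.piFinSuccAbove (fun _ : Fin (n + 1) => ℝ) (Fin.last n)).symm.trans
      (MeasurableEquiv.toLp 2 (Fin (n + 1) → ℝ))), fun zt => ?_, ?_⟩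
  · ext i
    simp [pt, MeasurableEquiv.piFinSuccAbove, Fin.insertNth_last', Fin.insertNthEquiv]
    rfl
  · exact h4.comp (h3.comp (h2.comp h1))

lemma normAp_eq (f : Euc (n + 1) → ℝ) (p l : ℝ) :
    normAp n f p l =
      ∫⁻ z in upperHS n, ENNReal.ofReal (|f z| ^ p) * ENNReal.ofReal (tp z ^ l) := by
  obtain ⟨e, he, hmp⟩ := exists_measurableEquiv_pt (n := n)
  have hU : (univ : Set (Euc n)) ×ˢ Ioi (0 : ℝ) = e ⁻¹' upperHS n := by
    ext zt; simp [he, upperHS, tp_pt]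
  rw [normAp, mLam, lintegral_withDensity_eq_lintegral_mul_non_measurable _ (by fun_prop)
    (Filter.Eventually.of_forall fun _ => ENNReal.ofReal_lt_top)]
  have hprod : (volume : Measure (Euc n)).prod ((volume : Measure ℝ).restrict (Ioi 0)) =
      ((volume : Measure (Euc n)).prod (volume : Measure ℝ)).restrict (e ⁻¹' upperHS n) := by
    rw [← hU, ← Measure.prod_restrict, Measure.restrict_univ]
  rw [hprod, ← hmp.setLIntegral_comp_preimage_emb e.measurableEmbedding]
  refine lintegral_congr fun zt => ?_
  simp only [Pi.mul_apply, he, tp_pt]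
  rw [mul_comm]

lemma rpow_le_max {a b u : ℝ} (ha : 0 < a) (hau : a ≤ u) (hub : u ≤ b) (l : ℝ) :
    u ^ l ≤ max (a ^ l) (b ^ l) := by
  rcases le_total 0 l with hl | hl
  · exact (Real.rpow_le_rpow (by linarith) hub hl).trans (le_max_right _ _)
  · exact (Real.rpow_le_rpow_of_nonpos ha hau hl).trans (le_max_left _ _)

lemma rpow_le_max_mul {a b t u : ℝ} (ha : 0 < a) (ht : 0 < t) (hau : a * t ≤ u)
    (hub : u ≤ b * t) (l : ℝ) : u ^ l ≤ max (a ^ l) (b ^ l) * t ^ l := by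
  have hu : 0 < u := lt_of_lt_of_le (by positivity) hau
  have h := rpow_le_max (u := u / t) ha ((le_div_iff₀ ht).2 hau) ((div_le_iff₀ ht).2 hub) l
  rwa [Real.div_rpow hu.le ht.le, div_le_iff₀ (by positivity)] at h

/-- The density of `|f|^p dm_l` with respect to Lebesgue measure, extended by zero. -/
def bergmanDensity (f : Euc (n + 1) → ℝ) (p l : ℝ) : Euc (n + 1) → ℝ≥0∞ :=
  (upperHS n).indicator fun z => ENNReal.ofReal (|f z| ^ p) * ENNReal.ofReal (tp z ^ l)

lemma lintegral_bergmanDensity (f : Euc (n + 1) → ℝ) (p l : ℝ) :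
    ∫⁻ z, bergmanDensity f p l z = normAp n f p l := by
  rw [normAp_eq, bergmanDensity, lintegral_indicator isOpen_upperHS.measurableSet]

lemma measurable_bergmanDensity {f : Euc (n + 1) → ℝ} (hf : ContinuousOn f (upperHS n))
    (p l : ℝ) : Measurable (bergmanDensity f p l) := by
  have hf' : Measurable ((upperHS n).indicator f) := by
    classical
    rw [← piecewise_eq_indicator]
    exact ContinuousOn.measurable_piecewise hf continuousOn_const isOpen_upperHS.measurableSet
  have hm : Measurable fun z : Euc (n + 1) => ENNReal.ofReal (|(upperHS n).indicator f z| ^ p) *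
      ENNReal.ofReal (tp z ^ l) := by
    have := (continuous_tp (n := n)).measurable
    fun_prop
  have : bergmanDensity f p l = (upperHS n).indicator (fun z =>
      ENNReal.ofReal (|(upperHS n).indicator f z| ^ p) * ENNReal.ofReal (tp z ^ l)) := by
    ext z
    by_cases hz : z ∈ upperHS n <;> simp [bergmanDensity, hz]
  rw [this]
  exact hm.indicator isOpen_upperHS.measurableSet

lemma exists_pointwise_le_lintegral_bergmanDensity {p : ℝ} (hp : 0 < p) (l : ℝ) :
    ∃ K : ℝ, 0 < K ∧ ∀ f : Euc (n + 1) → ℝ, HarmonicOnE f (upperHS n) → ∀ z ∈ upperHS n,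
      ENNReal.ofReal (|f z| ^ p) ≤ ENNReal.ofReal (K * tp z ^ (-((n + 1 : ℝ) + l))) *
        ∫⁻ w in Metric.closedBall z (tp z / 4), bergmanDensity f p l w := by
  obtain ⟨K, hK, hKf⟩ := exists_rpow_abs_mul_pow_le_integral (Nat.succ_ne_zero n) hp
  set M : ℝ := max ((3 / 4 : ℝ) ^ (-l)) ((5 / 4 : ℝ) ^ (-l)) with hM
  have hM0 : 0 < M := lt_max_of_lt_left (by positivity)
  refine ⟨4 ^ (n + 1) * K * M, by positivity, fun f hf z hz => ?_⟩
  have ht : 0 < tp z := hz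
  set t := tp z with htdef
  have hball : ∀ w ∈ Metric.closedBall z (t / 4), 3 / 4 * t ≤ tp w ∧ tp w ≤ 5 / 4 * t := by
    intro w hw
    have := (abs_tp_sub_le_dist w z).trans hw
    rw [abs_le] at this
    constructor <;> linarith [this.1, this.2]
  have hsub : Metric.closedBall z (t / 4) ⊆ upperHS n := fun w hw =>
    lt_of_lt_of_le (by positivity) (hball w hw).1
  have hmain := hKf f _ isOpen_upperHS hf z (t / 4) (by positivity) hsub
  have hInt : IntegrableOn (fun x => |f x| ^ p) (Metric.closedBall z (t / 4)) :=
    (((hf.1.continuousOn.mono hsub).abs).rpow_const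
      fun _ _ => Or.inr hp.le).integrableOn_compact (isCompact_closedBall _ _)
  have hle : |f z| ^ p ≤ 4 ^ (n + 1) * K * t ^ (-(n + 1 : ℝ)) *
      ∫ x in Metric.closedBall z (t / 4), |f x| ^ p := by
    have h1 : t ^ (-(n + 1 : ℝ)) * t ^ (n + 1) = 1 := by
      rw [← Real.rpow_natCast t (n + 1), ← Real.rpow_add ht]; simp
    calc |f z| ^ p = 4 ^ (n + 1) * t ^ (-(n + 1 : ℝ)) * (|f z| ^ p * (t / 4) ^ (n + 1)) := by
          rw [div_pow]
          field_simp
          linear_combination (-|f z| ^ p) * h1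
      _ ≤ 4 ^ (n + 1) * t ^ (-(n + 1 : ℝ)) *
          (K * ∫ x in Metric.closedBall z (t / 4), |f x| ^ p) := by gcongr
      _ = _ := by ring
  calc ENNReal.ofReal (|f z| ^ p)
      ≤ ENNReal.ofReal (4 ^ (n + 1) * K * t ^ (-(n + 1 : ℝ)) *
          ∫ x in Metric.closedBall z (t / 4), |f x| ^ p) := ENNReal.ofReal_le_ofReal hle
    _ = ENNReal.ofReal (4 ^ (n + 1) * K * t ^ (-(n + 1 : ℝ))) *
          ∫⁻ w in Metric.closedBall z (t / 4), ENNReal.ofReal (|f w| ^ p) := by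
        rw [ENNReal.ofReal_mul (by positivity), ofReal_integral_eq_lintegral_ofReal hInt
          (Filter.Eventually.of_forall fun x => by positivity)]
    _ ≤ ENNReal.ofReal (4 ^ (n + 1) * K * t ^ (-(n + 1 : ℝ))) *
          ∫⁻ w in Metric.closedBall z (t / 4),
            ENNReal.ofReal (M * t ^ (-l)) * bergmanDensity f p l w := by
        gcongr 1
        refine setLIntegral_mono' Metric.isClosed_closedBall.measurableSet fun w hw => ?_
        have hw0 : 0 < tp w := hsub hw
        rw [bergmanDensity, indicator_of_mem (hsub hw), mul_left_comm,
          ← ENNReal.ofReal_mul (by positivity)]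
        refine le_mul_of_one_le_right zero_le ?_
        rw [ENNReal.one_le_ofReal]
        have h2 := rpow_le_max_mul (a := 3 / 4) (b := 5 / 4) (by norm_num) ht (hball w hw).1
          (hball w hw).2 (-l)
        calc (1 : ℝ) = tp w ^ (-l) * tp w ^ l := by rw [← Real.rpow_add hw0]; simp
          _ ≤ _ := mul_le_mul_of_nonneg_right h2 (by positivity)
    _ = _ := by
        rw [lintegral_const_mul' _ _ ENNReal.ofReal_ne_top, ← mul_assoc,
          ← ENNReal.ofReal_mul (by positivity)]
        congr 2
        rw [neg_add (n + 1 : ℝ) l, Real.rpow_add ht]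
        ring

lemma exists_rpow_abs_le_normAp {p : ℝ} (hp : 0 < p) (l : ℝ) :
    ∃ K : ℝ, 0 < K ∧ ∀ f : Euc (n + 1) → ℝ, HarmonicOnE f (upperHS n) → ∀ z ∈ upperHS n,
      ENNReal.ofReal (|f z| ^ p) ≤
        ENNReal.ofReal (K * tp z ^ (-((n + 1 : ℝ) + l))) * normAp n f p l := by
  obtain ⟨K, hK, h⟩ := exists_pointwise_le_lintegral_bergmanDensity (n := n) hp l
  refine ⟨K, hK, fun f hf z hz => (h f hf z hz).trans ?_⟩
  rw [← lintegral_bergmanDensity]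
  gcongr
  exact Measure.restrict_le_self

lemma dist_le_of_mem_ball_quarter {z w : Euc (n + 1)} (h : dist w z ≤ tp z / 4) :
    4 / 5 * tp w ≤ tp z ∧ tp z ≤ 4 / 3 * tp w := by
  have := (abs_tp_sub_le_dist w z).trans h
  rw [abs_le] at this
  constructor <;> linarith [this.1, this.2]

lemma mem_Qcube_of_dist_le {z w : Euc (n + 1)} (h : dist z w ≤ tp w / 2) :
    z ∈ Qcube (xp w) (tp w) := by
  refine ⟨fun i => ?_, (abs_tp_sub_le_dist z w).trans h⟩
  have : xp w i = w i.castSucc := by simp [xp]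
  rw [this]
  exact (abs_apply_sub_le_dist z w _).trans h

section Carleson

variable {μ : Measure (Euc (n + 1))} {C θ : ℝ}

lemma sigmaFinite_restrict_upperHS
    (hC : ∀ (y : Euc n) (r : ℝ), 0 < r → μ (Qcube y r) ≤ ENNReal.ofReal (C * r ^ θ)) :
    SigmaFinite (μ.restrict (upperHS n)) := by
  have hfin : ∀ w : Euc (n + 1), w ∈ upperHS n → ∃ V, V ∈ nhds w ∧ IsOpen V ∧
      μ.restrict (upperHS n) V < ∞ := fun w hw => by
    have hw0 : 0 < tp w := hw
    refine ⟨Metric.ball w (tp w / 2), Metric.ball_mem_nhds _ (by positivity), Metric.isOpen_ball, ?_⟩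
    calc μ.restrict (upperHS n) (Metric.ball w (tp w / 2)) ≤ μ (Metric.ball w (tp w / 2)) :=
          Measure.restrict_apply_le _ _
      _ ≤ μ (Qcube (xp w) (tp w)) := measure_mono fun z hz =>
          mem_Qcube_of_dist_le (Metric.mem_ball.1 hz).le
      _ ≤ _ := hC _ _ hw0
      _ < ∞ := ENNReal.ofReal_lt_top
  choose! V hVn hVo hVf using hfin
  obtain ⟨T, hTU, hTc, hT⟩ := TopologicalSpace.countable_cover_nhdsWithin
    (s := upperHS n) (f := V) fun w hw => mem_nhdsWithin_of_mem_nhds (hVn w hw)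
  refine Measure.sigmaFinite_of_countable (S := insert (upperHS n)ᶜ (V '' T))
    ((hTc.image V).insert _) ?_ ?_
  · rintro s (rfl | ⟨w, hw, rfl⟩)
    · simp [Measure.restrict_apply isOpen_upperHS.measurableSet.compl]
    · exact hVf w (hTU hw)
  · refine eq_univ_of_forall fun z => ?_
    by_cases hz : z ∈ upperHS n
    · obtain ⟨w, hw, hzw⟩ := mem_iUnion₂.1 (hT hz)
      exact ⟨V w, mem_insert_of_mem _ (mem_image_of_mem V hw), hzw⟩
    · exact ⟨_, mem_insert _ _, hz⟩

lemma lintegral_kernel_le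
    (hC : ∀ (y : Euc n) (r : ℝ), 0 < r → μ (Qcube y r) ≤ ENNReal.ofReal (C * r ^ θ))
    {w : Euc (n + 1)} (hw : w ∈ upperHS n) :
    ∫⁻ z in upperHS n, {z | dist w z ≤ tp z / 4}.indicator
        (fun z => ENNReal.ofReal (tp z ^ (-θ))) z ∂μ ≤
      ENNReal.ofReal (max ((4 / 5 : ℝ) ^ (-θ)) ((4 / 3 : ℝ) ^ (-θ)) * C) := by
  have hw0 : 0 < tp w := hw
  set M : ℝ := max ((4 / 5 : ℝ) ^ (-θ)) ((4 / 3 : ℝ) ^ (-θ)) with hM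
  have hM0 : 0 < M := lt_max_of_lt_left (by positivity)
  set E : Set (Euc (n + 1)) := Metric.closedBall w (tp w / 2) with hE
  calc ∫⁻ z in upperHS n, {z | dist w z ≤ tp z / 4}.indicator
        (fun z => ENNReal.ofReal (tp z ^ (-θ))) z ∂μ
      ≤ ∫⁻ z in upperHS n, E.indicator (fun _ => ENNReal.ofReal (M * tp w ^ (-θ))) z ∂μ := by
        refine lintegral_mono fun z => ?_
        by_cases hz : z ∈ {z | dist w z ≤ tp z / 4}
        · have hb := dist_le_of_mem_ball_quarter hz
          have hzE : z ∈ E := by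
            rw [hE, Metric.mem_closedBall, dist_comm]
            have : dist w z ≤ tp z / 4 := hz
            linarith [hb.2]
          rw [indicator_of_mem hz, indicator_of_mem hzE]
          exact ENNReal.ofReal_le_ofReal
            (rpow_le_max_mul (by norm_num) hw0 hb.1 hb.2 _)
        · rw [indicator_of_notMem hz]; exact zero_le
    _ ≤ ∫⁻ z, E.indicator (fun _ => ENNReal.ofReal (M * tp w ^ (-θ))) z ∂μ :=
        setLIntegral_le_lintegral _ _
    _ = ENNReal.ofReal (M * tp w ^ (-θ)) * μ E :=
        lintegral_indicator_const Metric.isClosed_closedBall.measurableSet _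
    _ ≤ ENNReal.ofReal (M * tp w ^ (-θ)) * ENNReal.ofReal (C * tp w ^ θ) := by
        gcongr
        exact (measure_mono fun z hz => mem_Qcube_of_dist_le hz).trans (hC _ _ hw0)
    _ = ENNReal.ofReal (M * C) := by
        rw [← ENNReal.ofReal_mul (by positivity)]
        congr 1
        have : tp w ^ (-θ) * tp w ^ θ = 1 := by rw [← Real.rpow_add hw0]; simp
        linear_combination M * C * this

lemma lintegral_average_le
    (hC : ∀ (y : Euc n) (r : ℝ), 0 < r → μ (Qcube y r) ≤ ENNReal.ofReal (C * r ^ θ))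
    {h : Euc (n + 1) → ℝ≥0∞} (hh : Measurable h) (hsupp : ∀ w ∉ upperHS n, h w = 0) :
    ∫⁻ z in upperHS n, ENNReal.ofReal (tp z ^ (-θ)) *
        (∫⁻ w in Metric.closedBall z (tp z / 4), h w) ∂μ ≤
      ENNReal.ofReal (max ((4 / 5 : ℝ) ^ (-θ)) ((4 / 3 : ℝ) ^ (-θ)) * C) * ∫⁻ w, h w := by
  have := sigmaFinite_restrict_upperHS hC
  have htp := (continuous_tp (n := n)).measurable
  have hS : MeasurableSet {q : Euc (n + 1) × Euc (n + 1) | dist q.2 q.1 ≤ tp q.1 / 4} :=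
    (isClosed_le (by fun_prop)
      ((continuous_tp.comp continuous_fst).div_const 4)).measurableSet
  set k : Euc (n + 1) → Euc (n + 1) → ℝ≥0∞ := fun z w =>
    {z | dist w z ≤ tp z / 4}.indicator (fun z => ENNReal.ofReal (tp z ^ (-θ))) z * h w with hk
  have hkm : Measurable (Function.uncurry k) := by
    have h1 : Measurable ({q : Euc (n + 1) × Euc (n + 1) | dist q.2 q.1 ≤ tp q.1 / 4}.indicator
        (fun q => ENNReal.ofReal (tp q.1 ^ (-θ)))) :=
      Measurable.indicator (by fun_prop) hS
    exact h1.mul (hh.comp measurable_snd)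
  calc ∫⁻ z in upperHS n, ENNReal.ofReal (tp z ^ (-θ)) *
        (∫⁻ w in Metric.closedBall z (tp z / 4), h w) ∂μ
      = ∫⁻ z in upperHS n, (∫⁻ w, k z w) ∂μ := by
        refine lintegral_congr fun z => ?_
        rw [← lintegral_indicator Metric.isClosed_closedBall.measurableSet,
          ← lintegral_const_mul' _ _ ENNReal.ofReal_ne_top]
        refine lintegral_congr fun w => ?_
        by_cases hw : dist w z ≤ tp z / 4
        · simp [hk, indicator, hw]
        · simp [hk, indicator, hw]
    _ = ∫⁻ w, (∫⁻ z in upperHS n, k z w ∂μ) := lintegral_lintegral_swap hkm.aemeasurable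
    _ ≤ ∫⁻ w, ENNReal.ofReal (max ((4 / 5 : ℝ) ^ (-θ)) ((4 / 3 : ℝ) ^ (-θ)) * C) * h w := by
        refine lintegral_mono fun w => ?_
        by_cases hw : w ∈ upperHS n
        · simp only [hk]
          rw [lintegral_mul_const]
          · exact mul_le_mul_left (lintegral_kernel_le hC hw) _
          · refine Measurable.indicator (by fun_prop) ?_
            exact (isClosed_le (by fun_prop) (continuous_tp.div_const 4)).measurableSet
        · simp [hk, hsupp w hw]
    _ = _ := lintegral_const_mul _ hh

theorem product_inequality_of_carleson {k : ℕ} {p : ℝ} (hp : 0 < p) (s : Fin (k + 1) → ℝ)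
    (hC0 : 0 < C) (hθ : θ = ∑ j, ((n + 1 : ℝ) + s j))
    (hC : ∀ (y : Euc n) (r : ℝ), 0 < r → μ (Qcube y r) ≤ ENNReal.ofReal (C * r ^ θ)) :
    ∃ C' : ℝ, 0 < C' ∧ ∀ f : Fin (k + 1) → (Euc (n + 1) → ℝ),
      (∀ j, memAp n (f j) p (s j)) →
        (∫⁻ z in upperHS n, ENNReal.ofReal (∏ j, |f j z| ^ p) ∂μ) ≤
          ENNReal.ofReal C' * ∏ j, normAp n (f j) p (s j) := by
  obtain ⟨K₀, hK₀, h₀⟩ := exists_pointwise_le_lintegral_bergmanDensity (n := n) hp (s 0)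
  choose K hK hKf using fun j : Fin k => exists_rpow_abs_le_normAp (n := n) hp (s j.succ)
  set M : ℝ := max ((4 / 5 : ℝ) ^ (-θ)) ((4 / 3 : ℝ) ^ (-θ)) with hM
  have hM0 : 0 < M := lt_max_of_lt_left (by positivity)
  have hKp : 0 < ∏ j, K j := Finset.prod_pos fun j _ => hK j
  refine ⟨K₀ * (∏ j, K j) * (M * C), by positivity, fun f hf => ?_⟩
  set A : ℝ≥0∞ := ENNReal.ofReal (K₀ * ∏ j, K j) * ∏ j : Fin k, normAp n (f j.succ) p (s j.succ)
    with hA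
  have hpt : ∀ z ∈ upperHS n, ENNReal.ofReal (∏ j, |f j z| ^ p) ≤
      A * (ENNReal.ofReal (tp z ^ (-θ)) *
        ∫⁻ w in Metric.closedBall z (tp z / 4), bergmanDensity (f 0) p (s 0) w) := by
    intro z hz
    have ht : 0 < tp z := hz
    have hexp : tp z ^ (-θ) = tp z ^ (-((n + 1 : ℝ) + s 0)) *
        ∏ j : Fin k, tp z ^ (-((n + 1 : ℝ) + s j.succ)) := by
      rw [← Real.rpow_sum_of_pos ht, ← Real.rpow_add ht, hθ, Fin.sum_univ_succ, neg_add,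
        Finset.sum_neg_distrib]
    rw [ENNReal.ofReal_prod_of_nonneg fun j _ => by positivity, Fin.prod_univ_succ]
    refine (mul_le_mul' (h₀ _ (hf 0).1 z hz)
      (Finset.prod_le_prod' fun j _ => hKf j _ (hf j.succ).1 z hz)).trans_eq ?_
    rw [Finset.prod_mul_distrib, ← ENNReal.ofReal_prod_of_nonneg fun j _ => by
      have := hK j; positivity, Finset.prod_mul_distrib, hA, hexp]
    rw [ENNReal.ofReal_mul hK₀.le, ENNReal.ofReal_mul hKp.le, ENNReal.ofReal_mul hK₀.le,
      ENNReal.ofReal_mul (by positivity)]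
    ring
  calc (∫⁻ z in upperHS n, ENNReal.ofReal (∏ j, |f j z| ^ p) ∂μ)
      ≤ ∫⁻ z in upperHS n, A * (ENNReal.ofReal (tp z ^ (-θ)) *
        ∫⁻ w in Metric.closedBall z (tp z / 4), bergmanDensity (f 0) p (s 0) w) ∂μ :=
        setLIntegral_mono' isOpen_upperHS.measurableSet hpt
    _ ≤ A * ∫⁻ z in upperHS n, (ENNReal.ofReal (tp z ^ (-θ)) *
        ∫⁻ w in Metric.closedBall z (tp z / 4), bergmanDensity (f 0) p (s 0) w) ∂μ := by
        refine (lintegral_const_mul' _ _ ?_).le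
        exact ENNReal.mul_ne_top ENNReal.ofReal_ne_top
          (ENNReal.prod_ne_top fun j _ => (hf j.succ).2.ne)
    _ ≤ A * (ENNReal.ofReal (M * C) * ∫⁻ w, bergmanDensity (f 0) p (s 0) w) := by
        gcongr
        exact lintegral_average_le hC (measurable_bergmanDensity (hf 0).1.1.continuousOn _ _)
          fun w hw => indicator_of_notMem hw _
    _ = _ := by
        rw [lintegral_bergmanDensity, hA, Fin.prod_univ_succ,
          ENNReal.ofReal_mul (p := K₀ * ∏ j, K j) (by positivity)]
        ring

end Carleson

section AffineChange

variable {N : ℕ}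

lemma d2_comp_smul_add (f : Euc N → ℝ) (a : ℝ) (b z v : Euc N) :
    d2 (fun z => f (a • z + b)) z v = a ^ 2 * d2 f (a • z + b) v := by
  have h1 : ∀ z, fderiv ℝ (fun z => f (a • z + b)) z = a • fderiv ℝ f (a • z + b) := by
    intro z
    rw [fderiv_comp_smul (f := fun z => f (z + b)) a, fderiv_comp_add_right]
  have h2 : fderiv ℝ (fun z => fderiv ℝ f (a • z + b)) z =
      a • fderiv ℝ (fderiv ℝ f) (a • z + b) := by
    rw [fderiv_comp_smul (f := fun z => fderiv ℝ f (z + b)) a, fderiv_comp_add_right]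
  rw [d2_eq_fderiv_fderiv, d2_eq_fderiv_fderiv, funext h1]
  have h3 : fderiv ℝ (fun z => a • fderiv ℝ f (a • z + b)) z =
      a • fderiv ℝ (fun z => fderiv ℝ f (a • z + b)) z := 
    congrFun (fderiv_const_smul_field (f := fun z => fderiv ℝ f (a • z + b)) a) z
  rw [h3, h2]
  simp
  ring

lemma HarmonicOnE.comp_smul_add {f : Euc N → ℝ} {U : Set (Euc N)} (hf : HarmonicOnE f U) (a : ℝ)
    (b : Euc N) : HarmonicOnE (fun z => f (a • z + b)) {z | a • z + b ∈ U} := by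
  refine ⟨hf.1.comp (by fun_prop) fun z hz => hz, fun z hz => ?_⟩
  simp only [d2_comp_smul_add, ← Finset.mul_sum]
  rw [hf.2 _ hz, mul_zero]

lemma HarmonicOnE.mono {f : Euc N → ℝ} {U V : Set (Euc N)} (hf : HarmonicOnE f U) (h : V ⊆ U) :
    HarmonicOnE f V := ⟨hf.1.mono h, fun z hz => hf.2 z (h hz)⟩

lemma hasDerivAt_line (y v : Euc N) : HasDerivAt (fun t : ℝ => y + t • v) v 0 := by
  simpa using ((hasDerivAt_id (0 : ℝ)).smul_const v).const_add y

/-- Second derivatives computed along lines. -/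
lemma d2_eq_of_hasDerivAt {f : Euc N → ℝ} {U : Set (Euc N)} (hU : IsOpen U)
    (hf : ContDiffOn ℝ 2 f U) {x v : Euc N} (hx : x ∈ U) {g : Euc N → ℝ} {c : ℝ}
    (hg : ∀ y ∈ U, HasDerivAt (fun t : ℝ => f (y + t • v)) (g y) 0)
    (hc : HasDerivAt (fun t : ℝ => g (x + t • v)) c 0) : d2 f x v = c := by
  have h1 : ∀ y ∈ U, fderiv ℝ f y v = g y := fun y hy => by
    have h : HasFDerivAt f (fderiv ℝ f y) (y + (0 : ℝ) • v) := by
      simpa using ((hf.contDiffAt (hU.mem_nhds hy)).differentiableAt (by norm_num)).hasFDerivAt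
    exact (h.comp_hasDerivAt 0 (hasDerivAt_line y v)).unique (hg y hy)
  have hD : DifferentiableAt ℝ (fderiv ℝ f) x :=
    ((hf.contDiffAt (hU.mem_nhds hx)).fderiv_right (m := 1) (by norm_num)).differentiableAt
      (by norm_num)
  have h2 : HasFDerivAt (fun y => fderiv ℝ f y v) ((fderiv ℝ (fderiv ℝ f) x).flip v)
      (x + (0 : ℝ) • v) := by
    simpa using hD.hasFDerivAt.clm_apply (hasFDerivAt_const v x)
  have h3 : HasDerivAt (fun t : ℝ => fderiv ℝ f (x + t • v) v)
      ((fderiv ℝ (fderiv ℝ f) x).flip v v) 0 := by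
    have := h2.comp_hasDerivAt 0 (hasDerivAt_line x v)
    exact this
  have h4 : (fun t : ℝ => g (x + t • v)) =ᶠ[nhds 0] fun t => fderiv ℝ f (x + t • v) v := by
    have : Filter.Tendsto (fun t : ℝ => x + t • v) (nhds 0) (nhds x) := by
      simpa using (hasDerivAt_line x v).continuousAt.tendsto
    filter_upwards [this (hU.mem_nhds hx)] with t ht
    exact (h1 _ ht).symm
  rw [d2_eq_fderiv_fderiv, (hc.congr_of_eventuallyEq h4.symm).unique h3,
    ContinuousLinearMap.flip_apply]

end AffineChange

section KelvinHarmonic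

/-- The complex coordinate `t + i x₁` on `ℝ^{n+1}`. -/
def complexCoord (n : ℕ) [NeZero n] : Euc (n + 1) →L[ℝ] ℂ :=
  Complex.ofRealCLM.comp (EuclideanSpace.proj (Fin.last n)) +
    Complex.I • Complex.ofRealCLM.comp (EuclideanSpace.proj (Fin.castSucc (0 : Fin n)))

lemma hasDerivAt_norm_sq_rpow_line (a : ℝ) {y : Euc (n + 1)} (hy : y ≠ 0) (v : Euc (n + 1)) :
    HasDerivAt (fun t : ℝ => (‖y + t • v‖ ^ 2) ^ a)
      (2 * a * (‖y‖ ^ 2) ^ (a - 1) * inner ℝ y v) 0 := by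
  have h := (hasDerivAt_line y v).norm_sq.rpow_const (p := a) (Or.inl (by simpa using hy))
  simp only [zero_smul, add_zero] at h
  convert h using 1
  ring

variable [NeZero n]

lemma complexCoord_apply (v : Euc (n + 1)) :
    complexCoord n v = (tp v : ℂ) + Complex.I * (v (Fin.castSucc 0) : ℂ) := by
  simp [complexCoord, tp]

lemma norm_complexCoord_le (v : Euc (n + 1)) : ‖complexCoord n v‖ ≤ ‖v‖ := by
  have h1 : ‖complexCoord n v‖ ^ 2 = tp v ^ 2 + v (Fin.castSucc 0) ^ 2 := by
    rw [Complex.sq_norm, Complex.normSq_apply, complexCoord_apply]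
    simp
    ring
  have h2 : tp v ^ 2 + v (Fin.castSucc 0) ^ 2 ≤ ‖v‖ ^ 2 := by
    rw [EuclideanSpace.real_norm_sq_eq, Fin.sum_univ_castSucc, add_comm]
    have := Finset.single_le_sum (f := fun i : Fin n => v i.castSucc ^ 2) (fun i _ => sq_nonneg _)
      (Finset.mem_univ 0)
    simpa [tp] using this
  exact le_of_sq_le_sq (h1.trans_le h2) (norm_nonneg v)

lemma sum_complexCoord_single_sq :
    ∑ i, complexCoord n (EuclideanSpace.single i 1) ^ 2 = 0 := by
  rw [Fin.sum_univ_castSucc, Finset.sum_eq_single 0]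
  · simp [complexCoord_apply, tp, NeZero.ne n]
  · intro i _ hi
    have : (0 : Fin (n + 1)) ≠ i.castSucc := fun h => hi (Fin.castSucc_injective n h.symm)
    simp [complexCoord_apply, tp, Fin.castSucc_ne_last, this]
  · simp

lemma sum_mul_complexCoord_single (x : Euc (n + 1)) :
    ∑ i, (x i : ℂ) * complexCoord n (EuclideanSpace.single i 1) = complexCoord n x := by
  conv_rhs => rw [← (EuclideanSpace.basisFun (Fin (n + 1)) ℝ).sum_repr x]
  simp [map_sum]

/-- The Kelvin transform of the harmonic polynomial `Re (t + i x₁)^k`, when `2 * a = 1 - n - 2 * k`. -/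
def kelvin (n : ℕ) [NeZero n] (a : ℝ) (k : ℕ) (v : Euc (n + 1)) : ℝ :=
  (‖v‖ ^ 2) ^ a * (complexCoord n v ^ k).re

lemma contDiffOn_kelvin (a : ℝ) (k : ℕ) : ContDiffOn ℝ 2 (kelvin n a k) {0}ᶜ := by
  intro v hv
  refine ContDiffAt.contDiffWithinAt ?_
  have hv' : ‖v‖ ^ 2 ≠ 0 := by simpa using hv
  have h1 : ContDiffAt ℝ 2 (fun v : Euc (n + 1) => (‖v‖ ^ 2) ^ a) v :=
    (contDiff_norm_sq ℝ).contDiffAt.rpow_const_of_ne hv'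
  have h2 : ContDiff ℝ 2 fun v : Euc (n + 1) => (complexCoord n v ^ k).re :=
    Complex.reCLM.contDiff.comp ((complexCoord n).contDiff.pow k)
  exact h1.mul h2.contDiffAt

lemma abs_kelvin_le (a : ℝ) (k : ℕ) {v : Euc (n + 1)} (hv : v ≠ 0) :
    |kelvin n a k v| ≤ (‖v‖ ^ 2) ^ (a + k / 2) := by
  have hv' : 0 < ‖v‖ := norm_pos_iff.2 hv
  have h1 : |(complexCoord n v ^ k).re| ≤ ‖v‖ ^ k :=
    (Complex.abs_re_le_norm _).trans (by
      rw [norm_pow]; exact pow_le_pow_left₀ (norm_nonneg _) (norm_complexCoord_le v) k)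
  have h2 : ‖v‖ ^ k = (‖v‖ ^ 2) ^ ((k : ℝ) / 2) := by
    rw [← Real.rpow_natCast ‖v‖ 2, ← Real.rpow_mul hv'.le, ← Real.rpow_natCast]
    congr 1
    push_cast
    ring
  rw [kelvin, abs_mul, abs_of_nonneg (by positivity), Real.rpow_add (by positivity), ← h2]
  gcongr

lemma hasDerivAt_complexCoord_pow_line (k : ℕ) (c : ℂ) (y v : Euc (n + 1)) :
    HasDerivAt (fun t : ℝ => (complexCoord n (y + t • v) ^ k * c).re)
      ((k * complexCoord n y ^ (k - 1) * complexCoord n v * c).re) 0 := by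
  have h1 := (complexCoord n).hasFDerivAt.comp_hasDerivAt (0 : ℝ) (hasDerivAt_line y v)
  have h2 := Complex.reCLM.hasFDerivAt.comp_hasDerivAt (0 : ℝ) ((h1.pow k).mul_const c)
  simp only [Function.comp_def, zero_smul, add_zero] at h2
  exact h2

lemma d2_kelvin (a : ℝ) (k : ℕ) {x : Euc (n + 1)} (hx : x ≠ 0) (v : Euc (n + 1)) :
    d2 (kelvin n a k) x v =
      (2 * (a - 1) * (‖x‖ ^ 2) ^ (a - 2) * inner ℝ x v * (2 * a * inner ℝ x v) +
        (‖x‖ ^ 2) ^ (a - 1) * (2 * a * inner ℝ v v)) * (complexCoord n x ^ k).re +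
      2 * (2 * a * (‖x‖ ^ 2) ^ (a - 1) * inner ℝ x v *
        (k * complexCoord n x ^ (k - 1) * complexCoord n v).re) +
      (‖x‖ ^ 2) ^ a *
        ((k * (k - 1 : ℕ)) * complexCoord n x ^ (k - 2) * complexCoord n v ^ 2).re := by
  refine d2_eq_of_hasDerivAt isOpen_compl_singleton (contDiffOn_kelvin a k) hx
    (g := fun y => (2 * a * (‖y‖ ^ 2) ^ (a - 1) * inner ℝ y v) * (complexCoord n y ^ k).re +
      (‖y‖ ^ 2) ^ a * (k * complexCoord n y ^ (k - 1) * complexCoord n v).re) ?_ ?_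
  · intro y hy
    have h := (hasDerivAt_norm_sq_rpow_line a hy v).mul
      (hasDerivAt_complexCoord_pow_line k 1 y v)
    simp only [zero_smul, add_zero, mul_one] at h
    exact h
  · have h1 := hasDerivAt_norm_sq_rpow_line a hx v
    have h2 := hasDerivAt_norm_sq_rpow_line (a - 1) hx v
    have h3 := hasDerivAt_complexCoord_pow_line k 1 x v
    have h4 := hasDerivAt_complexCoord_pow_line (k - 1) (k * complexCoord n v) x v
    have h5 : HasDerivAt (fun t : ℝ => inner ℝ (x + t • v) v) (inner ℝ v v) 0 := by
      simpa using (hasDerivAt_line x v).inner ℝ (hasDerivAt_const (0 : ℝ) v)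
    have h := (((h2.const_mul (2 * a)).mul h5).mul h3).add (h1.mul h4)
    simp only [zero_smul, add_zero, mul_one] at h
    refine (h.congr_deriv ?_).congr_of_eventuallyEq (Filter.Eventually.of_forall fun t => ?_)
    · have e1 : a - 1 - 1 = a - 2 := by ring
      have e2 : k - 1 - 1 = k - 2 := by omega
      have e3 : ((k - 1 : ℕ) : ℂ) * complexCoord n x ^ (k - 2) * complexCoord n v *
          (k * complexCoord n v) =
          (k * (k - 1 : ℕ)) * complexCoord n x ^ (k - 2) * complexCoord n v ^ 2 := by ring
      have e4 : complexCoord n x ^ (k - 1) * (k * complexCoord n v) =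
          k * complexCoord n x ^ (k - 1) * complexCoord n v := by ring
      rw [e1, e2, e3, e4, Pi.mul_apply, zero_smul, add_zero]
      ring
    · have e4 : ∀ y, complexCoord n y ^ (k - 1) * (k * complexCoord n v) =
          k * complexCoord n y ^ (k - 1) * complexCoord n v := fun y => by ring
      simp only [Pi.add_apply, Pi.mul_apply, e4]

lemma harmonicOnE_kelvin {a : ℝ} {k : ℕ} (ha : 2 * a = 1 - n - 2 * k) :
    HarmonicOnE (kelvin n a k) {0}ᶜ := by
  refine ⟨contDiffOn_kelvin a k, fun x hx => ?_⟩
  have hx' : 0 < ‖x‖ ^ 2 := by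
    have : x ≠ 0 := hx
    positivity
  simp only [d2_kelvin a k hx, Finset.sum_add_distrib, ← Finset.mul_sum, ← Finset.sum_mul]
  have hin : ∀ i : Fin (n + 1), inner ℝ x (EuclideanSpace.single i (1 : ℝ)) = x i := fun i => by
    simp [EuclideanSpace.inner_single_right]
  have s1 : ∑ i : Fin (n + 1), 2 * (a - 1) * (‖x‖ ^ 2) ^ (a - 2) *
      inner ℝ x (EuclideanSpace.single i (1 : ℝ)) *
        (2 * a * inner ℝ x (EuclideanSpace.single i (1 : ℝ))) =
      4 * a * (a - 1) * (‖x‖ ^ 2) ^ (a - 1) := by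
    have : (‖x‖ ^ 2) ^ (a - 1) = (‖x‖ ^ 2) ^ (a - 2) * ∑ i, x i ^ 2 := by
      rw [← EuclideanSpace.real_norm_sq_eq, ← Real.rpow_add_one hx'.ne']
      congr 1; ring
    rw [this, Finset.mul_sum, Finset.mul_sum]
    exact Finset.sum_congr rfl fun i _ => by rw [hin]; ring
  have s2 : ∑ i : Fin (n + 1), (2 * a * (‖x‖ ^ 2) ^ (a - 1) *
      inner ℝ x (EuclideanSpace.single i (1 : ℝ)) *
        (k * complexCoord n x ^ (k - 1) * complexCoord n (EuclideanSpace.single i 1)).re) =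
      2 * a * (‖x‖ ^ 2) ^ (a - 1) * (k * (complexCoord n x ^ k).re) := by
    have e : (k : ℝ) * (complexCoord n x ^ k).re = ∑ i : Fin (n + 1),
        x i * (k * complexCoord n x ^ (k - 1) * complexCoord n (EuclideanSpace.single i 1)).re := by
      rcases Nat.eq_zero_or_pos k with rfl | hk
      · simp
      have : (k : ℂ) * complexCoord n x ^ k = ∑ i : Fin (n + 1),
          (x i : ℂ) * (k * complexCoord n x ^ (k - 1) *
            complexCoord n (EuclideanSpace.single i 1)) := by
        rw [← mul_pow_sub_one hk.ne', ← mul_assoc]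
        rw [mul_right_comm, show (k : ℂ) * complexCoord n x ^ (k - 1) * complexCoord n x = _ from
          congrArg _ (sum_mul_complexCoord_single x).symm, Finset.mul_sum]
        exact Finset.sum_congr rfl fun i _ => by ring
      have := congrArg Complex.re this
      rw [Complex.re_sum] at this
      simpa only [Complex.re_ofReal_mul, ← Complex.ofReal_natCast] using this
    rw [e, Finset.mul_sum]
    exact Finset.sum_congr rfl fun i _ => by rw [hin]; ring
  have s3 : ∑ i : Fin (n + 1), ((k * (k - 1 : ℕ)) * complexCoord n x ^ (k - 2) *
      complexCoord n (EuclideanSpace.single i 1) ^ 2).re = 0 := by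
    rw [← Complex.re_sum, ← Finset.mul_sum, sum_complexCoord_single_sq, mul_zero, Complex.zero_re]
  have s4 : ∑ i : Fin (n + 1), inner ℝ (EuclideanSpace.single i (1 : ℝ))
      (EuclideanSpace.single i (1 : ℝ)) = (n + 1 : ℝ) := by
    simp
  rw [s1, s2, s3, s4]
  linear_combination 2 * a * (‖x‖ ^ 2) ^ (a - 1) * (complexCoord n x ^ k).re * ha

end KelvinHarmonic

section TestFunctions

lemma normAp_comp_dilation {f : Euc (n + 1) → ℝ} (hf : ContinuousOn f (upperHS n)) (p l : ℝ)
    {r : ℝ} (hr : 0 < r) {c : Euc (n + 1)} (hc : tp c = 0) :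
    normAp n (fun z => f (r⁻¹ • (z - c))) p l =
      ENNReal.ofReal (r ^ ((n + 1 : ℝ) + l)) * normAp n f p l := by
  have htp : ∀ z, tp (r⁻¹ • (z - c)) = r⁻¹ * tp z := fun z => by
    simp only [tp] at hc
    simp [tp, hc]
  have hD : ∀ z, bergmanDensity (fun z => f (r⁻¹ • (z - c))) p l z =
      ENNReal.ofReal (r ^ l) * bergmanDensity f p l (r⁻¹ • (z - c)) := by
    intro z
    have hmem : r⁻¹ • (z - c) ∈ upperHS n ↔ z ∈ upperHS n := by
      simp [upperHS, htp, hr]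
    by_cases hz : z ∈ upperHS n
    · have hz' : 0 < tp z := hz
      have e : tp z ^ l = r ^ l * (r⁻¹ * tp z) ^ l := by
        rw [← Real.mul_rpow hr.le (by positivity), mul_inv_cancel_left₀ hr.ne']
      rw [bergmanDensity, bergmanDensity, indicator_of_mem hz, indicator_of_mem (hmem.2 hz), htp,
        e, ENNReal.ofReal_mul (by positivity)]
      ring
    · rw [bergmanDensity, bergmanDensity, indicator_of_notMem hz,
        indicator_of_notMem (mt hmem.1 hz), mul_zero]
  have hm := measurable_bergmanDensity hf p l
  rw [← lintegral_bergmanDensity, ← lintegral_bergmanDensity, lintegral_congr hD,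
    lintegral_const_mul _ (by fun_prop),
    lintegral_sub_right_eq_self (fun z => bergmanDensity f p l (r⁻¹ • z)) c,
    ← lintegral_map hm (measurable_const_smul r⁻¹),
    Measure.map_addHaar_smul _ (inv_ne_zero hr.ne'), lintegral_smul_measure, smul_eq_mul,
    ← mul_assoc, ← ENNReal.ofReal_mul (by positivity)]
  congr 2
  rw [finrank_euclideanSpace_fin, inv_pow, inv_inv, abs_of_pos (by positivity),
    Real.rpow_add hr, mul_comm, ← Real.rpow_natCast r (n + 1), Nat.cast_succ]

lemma lintegral_rpow_mul_one_add_rpow_lt_top {l q : ℝ} (hl : -1 < l) (hq : l + 1 < q) :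
    ∫⁻ t in Ioi (0 : ℝ), ENNReal.ofReal ((1 + t) ^ (-q)) * ENNReal.ofReal (t ^ l) < ⊤ := by
  rw [← Ioc_union_Ioi_eq_Ioi (zero_le_one (α := ℝ))]
  refine (lintegral_union_le _ _ _).trans_lt (ENNReal.add_lt_top.2 ⟨?_, ?_⟩)
  · have h : IntegrableOn (fun t : ℝ => t ^ l) (Ioc 0 1) :=
      (intervalIntegral.intervalIntegrable_rpow' hl).1
    refine (setLIntegral_mono' measurableSet_Ioc fun t ht => ?_).trans_lt h.lintegral_lt_top
    have : (1 + t) ^ (-q) ≤ 1 :=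
      Real.rpow_le_one_of_one_le_of_nonpos (by linarith [ht.1]) (by linarith)
    calc _ ≤ 1 * ENNReal.ofReal (t ^ l) := by
          gcongr
          simpa using this
      _ = _ := one_mul _
  · have h : IntegrableOn (fun t : ℝ => t ^ (-q + l)) (Ioi 1) :=
      integrableOn_Ioi_rpow_of_lt (by linarith) one_pos
    refine (setLIntegral_mono' measurableSet_Ioi fun t ht => ?_).trans_lt h.lintegral_lt_top
    have ht' : (1 : ℝ) < t := ht
    have ht0 : 0 < t := by linarith
    rw [Real.rpow_add ht0, ENNReal.ofReal_mul (by positivity)]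
    gcongr ENNReal.ofReal ?_ * _
    exact Real.rpow_le_rpow_of_nonpos ht0 (by linarith) (by linarith)

lemma norm_pt_sq (x : Euc n) (t : ℝ) : ‖pt x t‖ ^ 2 = ‖x‖ ^ 2 + t ^ 2 := by
  simp [EuclideanSpace.real_norm_sq_eq, Fin.sum_univ_castSucc, pt]

lemma pt_add_single (x : Euc n) (t : ℝ) :
    pt x t + EuclideanSpace.single (Fin.last n) 1 = pt x (1 + t) := by
  ext i
  refine Fin.lastCases ?_ (fun i => ?_) i
  · simp [pt, add_comm]
  · simp [pt, Fin.castSucc_ne_last]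

lemma normAp_translate_lt_top {G : Euc (n + 1) → ℝ} {b p l : ℝ} (hp : 0 < p)
    (hG : ∀ v ≠ 0, |G v| ≤ (‖v‖ ^ 2) ^ (-b)) (hl : -1 < l) (hn : n < b * p) (hlb : l + 1 < b * p) :
    normAp n (fun z => G (z + EuclideanSpace.single (Fin.last n) 1)) p l < ⊤ := by
  set q := b * p with hq
  have hq0 : 0 < q := by linarith
  have key : ∀ (x : Euc n) (t : ℝ), 0 < t →
      |G (pt x t + EuclideanSpace.single (Fin.last n) 1)| ^ p ≤
        2 ^ q * ((1 + ‖x‖) ^ (-q) * (1 + t) ^ (-q)) := by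
    intro x t ht
    have hv : (1 + ‖x‖) * (1 + t) / 2 ≤ ‖pt x (1 + t)‖ ^ 2 := by
      rw [norm_pt_sq]
      nlinarith [sq_nonneg (‖x‖ - (1 + t)), norm_nonneg x, sq_nonneg ‖x‖]
    have hpos : 0 < (1 + ‖x‖) * (1 + t) / 2 := by positivity
    have hv0 : pt x (1 + t) ≠ 0 := by
      intro h
      rw [h] at hv
      simp at hv
      linarith
    have hb0 : 0 < ‖pt x (1 + t)‖ ^ 2 := by positivity
    rw [pt_add_single]
    calc |G (pt x (1 + t))| ^ p ≤ ((‖pt x (1 + t)‖ ^ 2) ^ (-b)) ^ p := by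
          gcongr
          exact hG _ hv0
      _ = (‖pt x (1 + t)‖ ^ 2) ^ (-q) := by rw [← Real.rpow_mul hb0.le, neg_mul]
      _ ≤ ((1 + ‖x‖) * (1 + t) / 2) ^ (-q) :=
          Real.rpow_le_rpow_of_nonpos hpos hv (by linarith)
      _ = _ := by
          rw [Real.div_rpow (by positivity) (by positivity),
            Real.mul_rpow (by positivity) (by positivity), Real.rpow_neg zero_le_two q]
          field_simp
  have hx : ∫⁻ x : Euc n, ENNReal.ofReal ((1 + ‖x‖) ^ (-q)) < ⊤ :=
    finite_integral_one_add_norm (by simpa using hn)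
  have hbound : normAp n (fun z => G (z + EuclideanSpace.single (Fin.last n) 1)) p l ≤
      ∫⁻ zt : Euc n × ℝ, ENNReal.ofReal (2 ^ q) * (ENNReal.ofReal ((1 + ‖zt.1‖) ^ (-q)) *
        (ENNReal.ofReal ((1 + zt.2) ^ (-q)) * ENNReal.ofReal (zt.2 ^ l)))
        ∂((volume : Measure (Euc n)).prod ((volume : Measure ℝ).restrict (Ioi 0))) := by
    rw [normAp, mLam, lintegral_withDensity_eq_lintegral_mul_non_measurable _ (by fun_prop)
      (Filter.Eventually.of_forall fun _ => ENNReal.ofReal_lt_top)]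
    have hae : ∀ᵐ zt ∂((volume : Measure (Euc n)).prod ((volume : Measure ℝ).restrict (Ioi 0))),
        0 < zt.2 :=
      Measure.quasiMeasurePreserving_snd.ae (ae_restrict_mem measurableSet_Ioi)
    refine lintegral_mono_ae (hae.mono fun zt hzt => ?_)
    rw [Pi.mul_apply, mul_comm]
    calc _ ≤ ENNReal.ofReal (2 ^ q * ((1 + ‖zt.1‖) ^ (-q) * (1 + zt.2) ^ (-q))) *
          ENNReal.ofReal (zt.2 ^ l) := by
          gcongr
          exact key _ _ hzt
      _ = _ := by
          rw [ENNReal.ofReal_mul (by positivity), ENNReal.ofReal_mul (by positivity)]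
          ring
  refine hbound.trans_lt ?_
  rw [lintegral_const_mul _ (by fun_prop), lintegral_prod_mul
    (f := fun x : Euc n => ENNReal.ofReal ((1 + ‖x‖) ^ (-q)))
    (g := fun t : ℝ => ENNReal.ofReal ((1 + t) ^ (-q)) * ENNReal.ofReal (t ^ l))
    (by fun_prop) (by fun_prop)]
  exact ENNReal.mul_lt_top ENNReal.ofReal_lt_top
    (ENNReal.mul_lt_top hx (lintegral_rpow_mul_one_add_rpow_lt_top hl hlb))

lemma HarmonicOnE.comp_dilation {g : Euc (n + 1) → ℝ} (hg : HarmonicOnE g (upperHS n)) {r : ℝ}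
    (hr : 0 < r) {c : Euc (n + 1)} (hc : tp c = 0) :
    HarmonicOnE (fun z => g (r⁻¹ • (z - c))) (upperHS n) := by
  have e : ∀ z, r⁻¹ • (z - c) = r⁻¹ • z + -(r⁻¹ • c) := fun z => by
    rw [smul_sub, sub_eq_add_neg]
  simp only [e]
  refine (hg.comp_smul_add r⁻¹ (-(r⁻¹ • c))).mono fun z hz => ?_
  have hz' : 0 < z (Fin.last n) := hz
  have hc' : c (Fin.last n) = 0 := hc
  simp [upperHS, tp, hc', hz', hr]

lemma exists_memAp_pos [NeZero n] {p l : ℝ} (hp : 0 < p) (hl : -1 < l) :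
    ∃ g : Euc (n + 1) → ℝ, memAp n g p l ∧ 0 < g (EuclideanSpace.single (Fin.last n) 1) := by
  obtain ⟨k, hk⟩ := exists_nat_gt (2 * max (n : ℝ) (l + 1) / p - n + 1)
  set e : Euc (n + 1) := EuclideanSpace.single (Fin.last n) 1 with he
  set a : ℝ := (1 - n - 2 * k) / 2 with ha
  set b : ℝ := (n + k - 1) / 2 with hb
  have hbp : max (n : ℝ) (l + 1) < b * p := by
    have h : 2 * max (n : ℝ) (l + 1) / p < n + k - 1 := by linarith
    rw [div_lt_iff₀ hp] at h
    rw [hb]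
    linarith
  have hab : a + k / 2 = -b := by rw [ha, hb]; ring
  have hG : HarmonicOnE (kelvin n a k) {0}ᶜ := harmonicOnE_kelvin (by rw [ha]; ring)
  refine ⟨fun z => kelvin n a k (z + e), ⟨?_, ?_⟩, ?_⟩
  · have h := hG.comp_smul_add 1 e
    simp only [one_smul] at h
    refine h.mono fun z hz h0 => ?_
    have hz' : 0 < z (Fin.last n) := hz
    have : (z + e) (Fin.last n) = 0 := by rw [show z + e = 0 from h0]; simp
    simp [he] at this
    linarith
  · exact normAp_translate_lt_top hp (fun v hv => hab ▸ abs_kelvin_le a k hv) hl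
      ((le_max_left _ _).trans_lt hbp) ((le_max_right _ _).trans_lt hbp)
  · have h1 : complexCoord n (e + e) = ((2 : ℝ) : ℂ) := by
      simp [complexCoord_apply, he, tp, NeZero.ne n]
      norm_num
    have h2 : e + e ≠ 0 := by
      intro h
      rw [h, map_zero] at h1
      norm_num at h1
    have h3 : 0 < ‖e + e‖ := norm_pos_iff.2 h2
    change 0 < (‖e + e‖ ^ 2) ^ a * (complexCoord n (e + e) ^ k).re
    rw [h1, ← Complex.ofReal_pow, Complex.ofReal_re]
    positivity

/-- Testing a product inequality on dilates of fixed functions bounds the measure of the dilates of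
a fixed neighbourhood of `(0, 1)`. -/
lemma exists_nhds_measure_dilation_le [NeZero n] {μ : Measure (Euc (n + 1))} {C' θ p : ℝ} {m : ℕ}
    (hp : 0 < p) (s : Fin m → ℝ) (hs : ∀ j, -1 < s j) (hC' : 0 < C')
    (hθ : θ = ∑ j, ((n + 1 : ℝ) + s j))
    (h : ∀ f : Fin m → (Euc (n + 1) → ℝ), (∀ j, memAp n (f j) p (s j)) →
      (∫⁻ z in upperHS n, ENNReal.ofReal (∏ j, |f j z| ^ p) ∂μ) ≤
        ENNReal.ofReal C' * ∏ j, normAp n (f j) p (s j)) :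
    ∃ V : Set (Euc (n + 1)), IsOpen V ∧ EuclideanSpace.single (Fin.last n) 1 ∈ V ∧
      ∃ K : ℝ, 0 ≤ K ∧ ∀ (c : Euc (n + 1)) (r : ℝ), tp c = 0 → 0 < r →
        μ {z | r⁻¹ • (z - c) ∈ V} ≤ ENNReal.ofReal (K * r ^ θ) := by
  choose g hg hpos using fun j => exists_memAp_pos (n := n) hp (hs j)
  set e : Euc (n + 1) := EuclideanSpace.single (Fin.last n) 1 with he
  set V : Set (Euc (n + 1)) := upperHS n ∩ ⋂ j, upperHS n ∩ g j ⁻¹' Ioi (g j e / 2) with hV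
  set P : ℝ := ∏ j, (g j e / 2) ^ p with hP
  have hP0 : 0 < P := Finset.prod_pos fun j _ => Real.rpow_pos_of_pos (half_pos (hpos j)) p
  set J : ℝ := ∏ j, (normAp n (g j) p (s j)).toReal with hJ
  have hVo : IsOpen V := isOpen_upperHS.inter (isOpen_iInter_of_finite fun j =>
    (hg j).1.1.continuousOn.isOpen_inter_preimage isOpen_upperHS isOpen_Ioi)
  have heU : e ∈ upperHS n := by simp [upperHS, tp, he]
  refine ⟨V, hVo, ⟨heU, mem_iInter.2 fun j => ⟨heU, half_lt_self (hpos j)⟩⟩, C' * J / P, ?_, ?_⟩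
  · have : 0 ≤ J := Finset.prod_nonneg fun j _ => ENNReal.toReal_nonneg
    positivity
  intro c r hc hr
  set S : Set (Euc (n + 1)) := {z | r⁻¹ • (z - c) ∈ V} with hS
  have hSo : IsOpen S := hVo.preimage (by fun_prop)
  have hSU : S ⊆ upperHS n := by
    intro z hz
    have h0 : 0 < (r⁻¹ • (z - c)) (Fin.last n) := hz.1
    have hc' : c (Fin.last n) = 0 := hc
    simpa [upperHS, tp, hc', hr] using h0
  have hnorm : ∀ j, normAp n (fun z => g j (r⁻¹ • (z - c))) p (s j) =
      ENNReal.ofReal (r ^ ((n + 1 : ℝ) + s j) * (normAp n (g j) p (s j)).toReal) := fun j => by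
    rw [normAp_comp_dilation (hg j).1.1.continuousOn p (s j) hr hc,
      ENNReal.ofReal_mul (by positivity), ENNReal.ofReal_toReal (hg j).2.ne]
  have h1 := h (fun j z => g j (r⁻¹ • (z - c))) fun j =>
    ⟨(hg j).1.comp_dilation hr hc, by rw [hnorm]; exact ENNReal.ofReal_lt_top⟩
  have h2 : ENNReal.ofReal P * μ S ≤
      ∫⁻ z in upperHS n, ENNReal.ofReal (∏ j, |g j (r⁻¹ • (z - c))| ^ p) ∂μ := by
    rw [← setLIntegral_const]
    refine (setLIntegral_mono' hSo.measurableSet fun z hz => ?_).trans (lintegral_mono_set hSU)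
    refine ENNReal.ofReal_le_ofReal (Finset.prod_le_prod
      (fun j _ => Real.rpow_nonneg (half_pos (hpos j)).le p) fun j _ => ?_)
    exact Real.rpow_le_rpow (half_pos (hpos j)).le
      ((le_of_lt (mem_iInter.1 hz.2 j).2).trans (le_abs_self _)) hp.le
  have h3 : ENNReal.ofReal C' * ∏ j, normAp n (fun z => g j (r⁻¹ • (z - c))) p (s j) =
      ENNReal.ofReal (C' * J * r ^ θ) := by
    rw [Finset.prod_congr rfl fun j _ => hnorm j, ← ENNReal.ofReal_prod_of_nonneg
      fun j _ => by positivity, ← ENNReal.ofReal_mul hC'.le, Finset.prod_mul_distrib, hθ,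
      ← Real.rpow_sum_of_pos hr]
    congr 1
    ring
  have h4 := h2.trans (h1.trans_eq h3)
  rw [div_mul_eq_mul_div, ENNReal.ofReal_div_of_pos hP0, ENNReal.le_div_iff_mul_le
    (Or.inl (by simpa using hP0)) (Or.inl ENNReal.ofReal_ne_top), mul_comm]
  exact h4

lemma isCompact_Qcube (y : Euc n) (r : ℝ) : IsCompact (Qcube y r) := by
  have h : Qcube y r = EuclideanSpace.equiv (Fin (n + 1)) ℝ ⁻¹'
      univ.pi fun i => Icc (pt y r i - r / 2) (pt y r i + r / 2) := by
    ext z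
    have key : ∀ u v : ℝ, u ∈ Icc (v - r / 2) (v + r / 2) ↔ |u - v| ≤ r / 2 := fun u v => by
      rw [abs_le, mem_Icc]
      constructor <;> rintro ⟨h1, h2⟩ <;> constructor <;> linarith
    simp only [mem_preimage, mem_univ_pi, Fin.forall_fin_succ', key]
    simp [Qcube, tp, pt]
  rw [h]
  exact (EuclideanSpace.equiv (Fin (n + 1)) ℝ).toHomeomorph.isCompact_preimage.2
    (isCompact_univ_pi fun i => isCompact_Icc)

lemma carleson_of_product_inequality [NeZero n] {μ : Measure (Euc (n + 1))} {C' θ p : ℝ} {m : ℕ}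
    (hp : 0 < p) (s : Fin m → ℝ) (hs : ∀ j, -1 < s j) (hC' : 0 < C')
    (hθ : θ = ∑ j, ((n + 1 : ℝ) + s j))
    (h : ∀ f : Fin m → (Euc (n + 1) → ℝ), (∀ j, memAp n (f j) p (s j)) →
      (∫⁻ z in upperHS n, ENNReal.ofReal (∏ j, |f j z| ^ p) ∂μ) ≤
        ENNReal.ofReal C' * ∏ j, normAp n (f j) p (s j)) :
    ∃ C : ℝ, 0 < C ∧ ∀ (y : Euc n) (r : ℝ), 0 < r →
      μ (Qcube y r) ≤ ENNReal.ofReal (C * r ^ θ) := by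
  obtain ⟨V, hVo, heV, K, hK, hVK⟩ := exists_nhds_measure_dilation_le hp s hs hC' hθ h
  set e : Euc (n + 1) := EuclideanSpace.single (Fin.last n) 1 with he
  have hQ : ∀ w ∈ Qcube (0 : Euc n) 1, 0 < tp w := fun w hw => by
    linarith [(abs_le.1 hw.2).1]
  obtain ⟨T, hTQ, hT⟩ := (isCompact_Qcube (0 : Euc n) 1).elim_nhds_subcover
    (fun w => {z | (tp w)⁻¹ • (z - (w - tp w • e)) ∈ V}) fun w hw => by
      refine (hVo.preimage (by fun_prop)).mem_nhds ?_
      simpa [smul_smul, (hQ w hw).ne'] using heV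
  refine ⟨∑ w ∈ T, K * tp w ^ θ + 1, ?_, fun y r hr => ?_⟩
  · have : 0 ≤ ∑ w ∈ T, K * tp w ^ θ := Finset.sum_nonneg fun w hw =>
      mul_nonneg hK (Real.rpow_nonneg (hQ w (hTQ w hw)).le θ)
    linarith
  have hcover : Qcube y r ⊆ ⋃ w ∈ T,
      {z | (r * tp w)⁻¹ • (z - (pt y 0 + r • (w - tp w • e))) ∈ V} := by
    intro z hz
    have hz' : r⁻¹ • (z - pt y 0) ∈ Qcube (0 : Euc n) 1 := by
      have habs : ∀ u v : ℝ, |u - v| ≤ r / 2 → |r⁻¹ * (u - v)| ≤ 1 / 2 := fun u v huv => by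
        rw [abs_mul, abs_of_pos (inv_pos.2 hr), inv_mul_le_iff₀ hr]
        linarith
      refine ⟨fun i => ?_, ?_⟩
      · simpa [pt_castSucc] using habs _ _ (hz.1 i)
      · have e1 : tp (r⁻¹ • (z - pt y 0)) - 1 = r⁻¹ * (tp z - r) := by
          simp [tp, pt, mul_sub, hr.ne']
        rw [e1]
        exact habs _ _ hz.2
    obtain ⟨w, hw, hzw⟩ := mem_iUnion₂.1 (hT hz')
    refine mem_iUnion₂.2 ⟨w, hw, ?_⟩
    have e2 : (r * tp w)⁻¹ • (z - (pt y 0 + r • (w - tp w • e))) =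
        (tp w)⁻¹ • (r⁻¹ • (z - pt y 0) - (w - tp w • e)) := by
      rw [← sub_sub, mul_inv_rev, mul_smul, smul_sub r⁻¹ (z - pt y 0), inv_smul_smul₀ hr.ne']
    rw [mem_ofPred_eq, e2]
    exact hzw
  calc μ (Qcube y r) ≤ ∑ w ∈ T, μ {z | (r * tp w)⁻¹ • (z - (pt y 0 + r • (w - tp w • e))) ∈ V} :=
        (measure_mono hcover).trans (measure_biUnion_finset_le _ _)
    _ ≤ ∑ w ∈ T, ENNReal.ofReal (K * tp w ^ θ * r ^ θ) := by
        refine Finset.sum_le_sum fun w hw => ?_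
        have hw0 := hQ w (hTQ w hw)
        refine (hVK _ _ ?_ (mul_pos hr hw0)).trans_eq ?_
        · simp [tp, pt, he]
        · rw [Real.mul_rpow hr.le hw0.le]
          congr 1
          ring
    _ = ENNReal.ofReal ((∑ w ∈ T, K * tp w ^ θ) * r ^ θ) := by
        rw [Finset.sum_mul, ENNReal.ofReal_sum_of_nonneg fun w hw => ?_]
        have := hQ w (hTQ w hw)
        positivity
    _ ≤ _ := by
        gcongr
        linarith

end TestFunctions

end HalfSpace

/-- the Carleson condition is equivalent to the product inequality. -/
theorem stmt1 (n m : ℕ) (hn : 2 ≤ n) (hm : 1 ≤ m) (p : ℝ) (hp : 0 < p)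
    (s : Fin m → ℝ) (hs : ∀ j, -1 < s j)
    (μ : Measure (Euc (n + 1))) :
    (∃ C : ℝ, 0 < C ∧ ∀ (y : Euc n) (r : ℝ), 0 < r →
        μ (Qcube y r) ≤ ENNReal.ofReal (C * r ^ ((m * (n + 1) : ℝ) + ∑ j, s j))) ↔
    (∃ C' : ℝ, 0 < C' ∧ ∀ f : Fin m → (Euc (n + 1) → ℝ), (∀ j, memAp n (f j) p (s j)) →
        (∫⁻ z in upperHS n, ENNReal.ofReal (∏ j, |f j z| ^ p) ∂μ) ≤
          ENNReal.ofReal C' * ∏ j, normAp n (f j) p (s j)) := by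
  obtain ⟨k, rfl⟩ : ∃ k, m = k + 1 := ⟨m - 1, by omega⟩
  have : NeZero n := ⟨by omega⟩
  have hθ : (((k + 1 : ℕ) : ℝ) * (n + 1) + ∑ j, s j) = ∑ j, ((n + 1 : ℝ) + s j) := by
    simp [Finset.sum_add_distrib, mul_add]
  constructor
  · rintro ⟨C, hC0, hC⟩
    exact product_inequality_of_carleson hp s hC0 hθ hC
  · rintro ⟨C', hC', h⟩
    exact carleson_of_product_inequality hp s hs hC' hθ h

end
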